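/- arXiv:1707.02616 — 4 statements merged into one kernel-verified Lean document; each statement's English description precedes it below -/
import Mathlib

section
/- Let ψ : ℝ → ℝ be smooth with all derivatives bounded, and let λ : ℝ → ℝ be smooth and everywhere positive. Then the function t ↦ ∫_ℝ ψ(x/λ(t)) u₁(t,x) u₂(t,x) dx is differentiable, and its derivative equals −(λ'(t)/λ(t)) ∫ (x/λ(t)) ψ'(x/λ(t)) u₁u₂ dx − (1/(2λ(t))) ∫ ψ'(x/λ(t)) u₂² dx − (1/(2λ(t))) ∫ ψ'(x/λ(t)) u₁² dx + (1/(2λ(t)³)) ∫ ψ'''(x/λ(t)) u₁² dx − (3/(2λ(t))) ∫ ψ'(x/λ(t)) (∂ₓu₁)² dx + (1/λ(t)) ∫ ψ'(x/λ(t)) (u₁ f(u₁) − F(u₁)) dx, where all integrals are over x ∈ ℝ and integrands are evaluated at (t,x). -/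
open MeasureTheory Filter

lemma integrable_bounded_mul {p a : ℝ → ℝ} (hp : Continuous p) (hb : ∃ M, ∀ x, |p x| ≤ M)
    (ha : Integrable a) : Integrable (fun x => p x * a x) := by
  obtain ⟨M, hM⟩ := hb
  exact ha.bdd_mul hp.aestronglyMeasurable (Eventually.of_forall hM)

lemma integrable_inv_one_add_abs_sq : Integrable (fun x : ℝ => ((1 + |x|) ^ 2)⁻¹) := by
  have h := integrable_one_add_norm (E := ℝ) (μ := volume) (r := 2) (by simp)
  refine h.congr (Eventually.of_forall fun x => ?_)
  simp

lemma abs_le_mul_inv_one_add_abs_sq {a x M : ℝ} (h : (1 + |x|) ^ 2 * |a| ≤ M) :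
    |a| ≤ M * ((1 + |x|) ^ 2)⁻¹ := by
  rw [← div_eq_mul_inv, le_div_iff₀ (by positivity)]
  linarith

lemma abs_mul_le_mul_inv_one_add_abs_sq {a x M : ℝ} (h : (1 + |x|) ^ 3 * |a| ≤ M) :
    |x * a| ≤ M * ((1 + |x|) ^ 2)⁻¹ := by
  apply abs_le_mul_inv_one_add_abs_sq
  refine le_trans ?_ h
  rw [abs_mul, pow_succ (1 + |x|) 2, mul_assoc]
  gcongr
  linarith

lemma integrable_of_one_add_abs_sq_mul_le {g : ℝ → ℝ} (hg : Continuous g)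
    (h : ∃ M, ∀ x, (1 + |x|) ^ 2 * |g x| ≤ M) : Integrable g := by
  obtain ⟨M, hM⟩ := h
  exact (integrable_inv_one_add_abs_sq.const_mul M).mono' hg.aestronglyMeasurable
    (Eventually.of_forall fun x => abs_le_mul_inv_one_add_abs_sq (hM x))

lemma exists_abs_comp_le {f v : ℝ → ℝ} (hf : Continuous f) (hv : ∃ M, ∀ x, |v x| ≤ M) :
    ∃ M, ∀ x, |f (v x)| ≤ M := by
  obtain ⟨M, hM⟩ := hv
  obtain ⟨C, hC⟩ := (isCompact_Icc (a := -M) (b := M)).exists_bound_of_continuousOn hf.continuousOn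
  exact ⟨C, fun x => hC _ (abs_le.mp (hM x))⟩

lemma integrable_primitive_comp {f v : ℝ → ℝ} (hf : Continuous f) (hv : Continuous v)
    (hb : ∃ M, ∀ x, |v x| ≤ M) (hi : Integrable v) :
    Integrable (fun x => ∫ r in (0 : ℝ)..v x, f r) := by
  obtain ⟨M, hM⟩ := hb
  obtain ⟨C, hC⟩ := (isCompact_Icc (a := -M) (b := M)).exists_bound_of_continuousOn hf.continuousOn
  have hF : Continuous (fun y => ∫ r in (0 : ℝ)..y, f r) :=
    intervalIntegral.continuous_primitive (fun a b => hf.intervalIntegrable a b) 0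
  refine (hi.norm.const_mul C).mono' (hF.comp hv).aestronglyMeasurable
    (Eventually.of_forall fun x => ?_)
  have hx := abs_le.mp (hM x)
  have hM0 : 0 ≤ M := (abs_nonneg _).trans (hM x)
  have h := intervalIntegral.norm_integral_le_of_norm_le_const (a := 0) (b := v x) (f := f) (C := C)
    (fun r hr => hC r (Set.uIcc_subset_Icc ⟨by linarith, hM0⟩ hx (Set.uIoc_subset_uIcc hr)))
  simpa using h

lemma hasDerivAt_iteratedDeriv {g : ℝ → ℝ} (hg : ContDiff ℝ (⊤ : ℕ∞) g) (n : ℕ) (x : ℝ) :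
    HasDerivAt (iteratedDeriv n g) (iteratedDeriv (n + 1) g x) x := by
  rw [iteratedDeriv_succ]
  exact (hg.differentiable_iteratedDeriv n (by exact_mod_cast WithTop.coe_lt_top n) x).hasDerivAt

/-- Integration by parts behind the virial identity: `v`, `w` are the components at a fixed time. -/
lemma integral_virial_flux {ψ f v w : ℝ → ℝ} {l : ℝ} (hl : l ≠ 0)
    (hψ : ContDiff ℝ (⊤ : ℕ∞) ψ) (hψb : ∀ n : ℕ, ∃ M : ℝ, ∀ x : ℝ, |iteratedDeriv n ψ x| ≤ M)
    (hf : ContDiff ℝ (⊤ : ℕ∞) f) (hv : ContDiff ℝ (⊤ : ℕ∞) v) (hw : ContDiff ℝ (⊤ : ℕ∞) w)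
    (hvb : ∀ n : ℕ, ∃ M : ℝ, ∀ x : ℝ, |iteratedDeriv n v x| ≤ M)
    (hwb : ∀ n : ℕ, ∃ M : ℝ, ∀ x : ℝ, |iteratedDeriv n w x| ≤ M)
    (hvi : ∀ n : ℕ, Integrable (iteratedDeriv n v))
    (hwi : ∀ n : ℕ, Integrable (iteratedDeriv n w)) :
    (∫ x : ℝ, ψ (x / l) * (deriv w x * w x
        + v x * deriv (fun y => v y - deriv (deriv v) y - f (v y)) x))
      = - (1 / (2 * l)) * (∫ x : ℝ, deriv ψ (x / l) * (w x) ^ 2)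
        - (1 / (2 * l)) * (∫ x : ℝ, deriv ψ (x / l) * (v x) ^ 2)
        + (1 / (2 * l ^ 3)) * (∫ x : ℝ, iteratedDeriv 3 ψ (x / l) * (v x) ^ 2)
        - (3 / (2 * l)) * (∫ x : ℝ, deriv ψ (x / l) * (deriv v x) ^ 2)
        + (1 / l) * (∫ x : ℝ, deriv ψ (x / l)
            * (v x * f (v x) - ∫ r in (0:ℝ)..(v x), f r)) := by
  have dψ (n : ℕ) (x : ℝ) : HasDerivAt (fun y => iteratedDeriv n ψ (y / l))
      (iteratedDeriv (n + 1) ψ (x / l) * (1 / l)) x :=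
    (hasDerivAt_iteratedDeriv hψ n (x / l)).comp (h := fun y => y / l) x
      ((hasDerivAt_id x).div_const l)
  have dv := hasDerivAt_iteratedDeriv hv
  have dw := hasDerivAt_iteratedDeriv hw
  have df (x : ℝ) : HasDerivAt (fun y => f (v y)) (deriv f (v x) * iteratedDeriv 1 v x) x := by
    have h := dv 0 x
    rw [iteratedDeriv_zero] at h
    exact ((hf.differentiable (by simp)) (v x)).hasDerivAt.comp x h
  have dF (x : ℝ) : HasDerivAt (fun y => ∫ r in (0:ℝ)..(v y), f r)
      (f (v x) * iteratedDeriv 1 v x) x := by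
    have h := dv 0 x
    rw [iteratedDeriv_zero] at h
    exact (hf.continuous.integral_hasStrictDerivAt 0 (v x)).hasDerivAt.comp x h
  have cψ (n : ℕ) : Continuous (fun y => iteratedDeriv n ψ (y / l)) :=
    continuous_iff_continuousAt.mpr fun x => (dψ n x).continuousAt
  have cv (n : ℕ) : Continuous (iteratedDeriv n v) :=
    continuous_iff_continuousAt.mpr fun x => (dv n x).continuousAt
  have cw (n : ℕ) : Continuous (iteratedDeriv n w) :=
    continuous_iff_continuousAt.mpr fun x => (dw n x).continuousAt
  have bψ (n : ℕ) : ∃ M, ∀ x, |iteratedDeriv n ψ (x / l)| ≤ M :=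
    (hψb n).imp fun M hM x => hM _
  have iψ (n : ℕ) {a : ℝ → ℝ} (ha : Integrable a) :
      Integrable (fun x => iteratedDeriv n ψ (x / l) * a x) :=
    integrable_bounded_mul (cψ n) (bψ n) ha
  have ivv (m n : ℕ) : Integrable (fun x => iteratedDeriv m v x * iteratedDeriv n v x) :=
    integrable_bounded_mul (cv m) (hvb m) (hvi n)
  have iww (m n : ℕ) : Integrable (fun x => iteratedDeriv m w x * iteratedDeriv n w x) :=
    integrable_bounded_mul (cw m) (hwb m) (hwi n)
  have vb : ∃ M, ∀ x, |v x| ≤ M := by simpa using hvb 0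
  have ivf : Integrable (fun x => f (v x) * iteratedDeriv 0 v x) :=
    integrable_bounded_mul (hf.continuous.comp hv.continuous)
      (exists_abs_comp_le hf.continuous vb) (hvi 0)
  have hf' : Continuous (deriv f) := hf.continuous_deriv (by simp)
  have ivdf : Integrable (fun x => deriv f (v x) * (iteratedDeriv 0 v x * iteratedDeriv 1 v x)) :=
    integrable_bounded_mul (hf'.comp hv.continuous) (exists_abs_comp_le hf' vb) (ivv 0 1)
  have iF : Integrable (fun x => ∫ r in (0:ℝ)..(v x), f r) :=
    integrable_primitive_comp hf.continuous hv.continuous vb (by simpa using hvi 0)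
  have hflux (x : ℝ) : deriv (fun y => v y - deriv (deriv v) y - f (v y)) x
      = iteratedDeriv 1 v x - iteratedDeriv 3 v x - deriv f (v x) * iteratedDeriv 1 v x := by
    have h := (((dv 0 x).sub (dv 2 x)).sub (df x)).deriv
    simpa [iteratedDeriv_succ, Pi.sub_def] using h
  have iL := iψ 0 ((iww 1 0).add (((ivv 0 1).sub (ivv 0 3)).sub ivdf))
  have i1 := (iψ 1 (iww 0 0)).const_mul (1 / (2 * l))
  have i2 := (iψ 1 (ivv 0 0)).const_mul (1 / (2 * l))
  have i3 := (iψ 3 (ivv 0 0)).const_mul (1 / (2 * l ^ 3))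
  have i4 := (iψ 1 (ivv 1 1)).const_mul (3 / (2 * l))
  have i5 := (iψ 1 (ivf.sub iF)).const_mul (1 / l)
  have iA := iψ 0 ((((((iww 0 0).const_mul (1 / 2)).add ((ivv 0 0).const_mul (1 / 2))).sub
    (ivv 0 2)).add ((ivv 1 1).const_mul (1 / 2))).sub (ivf.sub iF))
  have iB := (((iψ 1 (ivv 0 1)).const_mul (1 / l)).sub
    ((iψ 2 (ivv 0 0)).const_mul (1 / (2 * l ^ 2))))
  have key := integral_eq_zero_of_hasDerivAt_of_integrable (fun x => ?_)
    (((((iL.add i1).add i2).sub i3).add i4).sub i5) (iA.add iB)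
  · rw [integral_sub' ((((iL.add i1).add i2).sub i3).add i4) i5,
      integral_add' (((iL.add i1).add i2).sub i3) i4, integral_sub' ((iL.add i1).add i2) i3,
      integral_add' (iL.add i1) i2, integral_add' iL i1] at key
    simp only [integral_const_mul, Pi.add_apply, Pi.sub_apply, iteratedDeriv_zero] at key
    have hL : (∫ x : ℝ, ψ (x / l) * (deriv w x * w x
        + v x * deriv (fun y => v y - deriv (deriv v) y - f (v y)) x))
        = ∫ x : ℝ, ψ (x / l) * (iteratedDeriv 1 w x * w x + (v x * iteratedDeriv 1 v x
          - v x * iteratedDeriv 3 v x - deriv f (v x) * (v x * iteratedDeriv 1 v x))) := by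
      refine integral_congr_ae (Eventually.of_forall fun x => ?_)
      simp only [hflux, iteratedDeriv_one]
      ring
    rw [hL]
    simp only [← iteratedDeriv_one (f := ψ), ← iteratedDeriv_one (f := v), pow_two, mul_comm (v _) (f _)]
    linear_combination key
  · have hA := (dψ 0 x).mul (((((((dw 0 x).mul (dw 0 x)).const_mul (1 / 2)).add
      (((dv 0 x).mul (dv 0 x)).const_mul (1 / 2))).sub ((dv 0 x).mul (dv 2 x))).add
      (((dv 1 x).mul (dv 1 x)).const_mul (1 / 2))).sub (((df x).mul (dv 0 x)).sub (dF x)))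
    have hB := (((dψ 1 x).mul ((dv 0 x).mul (dv 1 x))).const_mul (1 / l)).sub
      (((dψ 2 x).mul ((dv 0 x).mul (dv 0 x))).const_mul (1 / (2 * l ^ 2)))
    refine (hA.add hB).congr_deriv ?_
    simp only [Pi.add_apply, Pi.sub_apply, Pi.mul_apply, iteratedDeriv_zero]
    field_simp
    ring

lemma contDiff_fst_slice {u : ℝ → ℝ → ℝ} (hu : ContDiff ℝ (⊤ : ℕ∞) (fun q : ℝ × ℝ => u q.1 q.2))
    (x : ℝ) : ContDiff ℝ (⊤ : ℕ∞) (fun s => u s x) :=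
  hu.comp (contDiff_id.prodMk contDiff_const)

lemma contDiff_snd_slice {u : ℝ → ℝ → ℝ} (hu : ContDiff ℝ (⊤ : ℕ∞) (fun q : ℝ × ℝ => u q.1 q.2))
    (t : ℝ) : ContDiff ℝ (⊤ : ℕ∞) (u t) :=
  hu.comp (contDiff_const.prodMk contDiff_id)

lemma continuous_deriv_fst_slice {u : ℝ → ℝ → ℝ}
    (hu : ContDiff ℝ (⊤ : ℕ∞) (fun q : ℝ × ℝ => u q.1 q.2)) (t : ℝ) :
    Continuous (fun x => deriv (fun s => u s x) t) := by
  have h (x : ℝ) : deriv (fun s => u s x) t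
      = fderiv ℝ (fun q : ℝ × ℝ => u q.1 q.2) (t, x) (1, 0) := by
    have hd := ((hu.differentiable (by simp)) (t, x)).hasFDerivAt
    exact (hd.comp_hasDerivAt (f := fun s : ℝ => (s, x)) t
      ((hasDerivAt_id t).prodMk (hasDerivAt_const t x))).deriv
  simp_rw [h]
  exact ((hu.continuous_fderiv (by simp)).comp (by fun_prop)).clm_apply continuous_const

/-- Differentiation under the integral sign for the localized momentum. -/
lemma hasDerivAt_integral_scaled_weight {ψ lam : ℝ → ℝ} {u₁ u₂ : ℝ → ℝ → ℝ}
    (hu₁ : ContDiff ℝ (⊤ : ℕ∞) (fun q : ℝ × ℝ => u₁ q.1 q.2))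
    (hu₂ : ContDiff ℝ (⊤ : ℕ∞) (fun q : ℝ × ℝ => u₂ q.1 q.2))
    (hdec₁ : ∀ T : ℝ, ∀ m n : ℕ, ∃ M : ℝ, ∀ t ∈ Set.Icc (-T) T, ∀ x : ℝ,
      (1 + |x|) ^ n * |iteratedDeriv m (fun s => u₁ s x) t| ≤ M)
    (hdec₂ : ∀ T : ℝ, ∀ m n : ℕ, ∃ M : ℝ, ∀ t ∈ Set.Icc (-T) T, ∀ x : ℝ,
      (1 + |x|) ^ n * |iteratedDeriv m (fun s => u₂ s x) t| ≤ M)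
    (hψ : ContDiff ℝ (⊤ : ℕ∞) ψ) (hψb : ∀ n : ℕ, ∃ M : ℝ, ∀ x : ℝ, |iteratedDeriv n ψ x| ≤ M)
    (hlam : ContDiff ℝ (⊤ : ℕ∞) lam) (hlampos : ∀ t : ℝ, 0 < lam t) (t : ℝ) :
    HasDerivAt (fun s => ∫ x : ℝ, ψ (x / lam s) * (u₁ s x * u₂ s x))
      (-(deriv lam t / lam t) *
          (∫ x : ℝ, (x / lam t) * deriv ψ (x / lam t) * (u₁ t x * u₂ t x))
        + ∫ x : ℝ, ψ (x / lam t) * (deriv (fun s => u₁ s x) t * u₂ t x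
            + u₁ t x * deriv (fun s => u₂ s x) t)) t := by
  have hlam0 (s : ℝ) : lam s ≠ 0 := (hlampos s).ne'
  have cψ : Continuous ψ := hψ.continuous
  have cψ' : Continuous (deriv ψ) := hψ.continuous_deriv (by simp)
  have cr : Continuous (fun s => deriv lam s / lam s ^ 2) :=
    (hlam.continuous_deriv (by simp)).div (hlam.continuous.pow 2) fun s => pow_ne_zero 2 (hlam0 s)
  have c₁ (s : ℝ) : Continuous (u₁ s) := (contDiff_snd_slice hu₁ s).continuous
  have c₂ (s : ℝ) : Continuous (u₂ s) := (contDiff_snd_slice hu₂ s).continuous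
  obtain ⟨P₀, hP₀⟩ := hψb 0
  obtain ⟨P₁, hP₁⟩ := hψb 1
  obtain ⟨L, hL⟩ := (isCompact_Icc (a := -(|t| + 1)) (b := |t| + 1)).exists_bound_of_continuousOn
    cr.continuousOn
  obtain ⟨A, hA⟩ := hdec₁ (|t| + 1) 0 0
  obtain ⟨A', hA'⟩ := hdec₁ (|t| + 1) 1 0
  obtain ⟨B, hB⟩ := hdec₂ (|t| + 1) 0 2
  obtain ⟨C, hC⟩ := hdec₂ (|t| + 1) 0 3
  obtain ⟨B', hB'⟩ := hdec₂ (|t| + 1) 1 2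
  simp only [iteratedDeriv_zero, iteratedDeriv_one, pow_zero, one_mul] at hP₀ hP₁ hA hA' hB hC hB'
  have hball {s : ℝ} (hs : s ∈ Metric.ball t 1) : s ∈ Set.Icc (-(|t| + 1)) (|t| + 1) := by
    rw [Metric.mem_ball, Real.dist_eq] at hs
    apply abs_le.mp
    calc |s| = |(s - t) + t| := by ring_nf
      _ ≤ |s - t| + |t| := abs_add_le _ _
      _ ≤ |t| + 1 := by linarith
  have hbound₁ {s : ℝ} (hs : s ∈ Metric.ball t 1) (x : ℝ) :
      |deriv ψ (x / lam s) * (deriv lam s / lam s ^ 2) * u₁ s x * (x * u₂ s x)|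
        ≤ P₁ * L * A * (C * ((1 + |x|) ^ 2)⁻¹) := by
    have h₁ := hP₁ (x / lam s)
    have h₂ : |deriv lam s / lam s ^ 2| ≤ L := hL s (hball hs)
    have h₃ := hA s (hball hs) x
    have h₄ := abs_mul_le_mul_inv_one_add_abs_sq (hC s (hball hs) x)
    have := (abs_nonneg _).trans h₁
    have := (abs_nonneg _).trans h₂
    have := (abs_nonneg _).trans h₃
    rw [abs_mul, abs_mul, abs_mul]
    gcongr
  have hbound₂ {s : ℝ} (hs : s ∈ Metric.ball t 1) (x : ℝ) :
      |ψ (x / lam s) * (deriv (fun r => u₁ r x) s * u₂ s x + u₁ s x * deriv (fun r => u₂ r x) s)|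
        ≤ P₀ * (A' * (B * ((1 + |x|) ^ 2)⁻¹) + A * (B' * ((1 + |x|) ^ 2)⁻¹)) := by
    have h₁ := hP₀ (x / lam s)
    have h₂ := hA s (hball hs) x
    have h₃ := hA' s (hball hs) x
    have h₄ := abs_le_mul_inv_one_add_abs_sq (hB s (hball hs) x)
    have h₅ := abs_le_mul_inv_one_add_abs_sq (hB' s (hball hs) x)
    have hP₀ := (abs_nonneg _).trans h₁
    have := (abs_nonneg _).trans h₂
    have := (abs_nonneg _).trans h₃
    rw [abs_mul]
    refine mul_le_mul h₁ ((abs_add_le _ _).trans ?_) (abs_nonneg _) hP₀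
    rw [abs_mul, abs_mul]
    gcongr
  have ht : t ∈ Metric.ball t 1 := Metric.mem_ball_self one_pos
  have hw := integrable_inv_one_add_abs_sq
  have hm₁ : Continuous (fun x =>
      deriv ψ (x / lam t) * (deriv lam t / lam t ^ 2) * u₁ t x * (x * u₂ t x)) := by
    have := c₁ t
    have := c₂ t
    fun_prop
  have hm₂ : Continuous (fun x => ψ (x / lam t) *
      (deriv (fun r => u₁ r x) t * u₂ t x + u₁ t x * deriv (fun r => u₂ r x) t)) := by
    have := c₁ t
    have := c₂ t
    have := continuous_deriv_fst_slice hu₁ t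
    have := continuous_deriv_fst_slice hu₂ t
    fun_prop
  have hg₁ := ((hw.const_mul C).const_mul (P₁ * L * A))
  have hg₂ := (((hw.const_mul B).const_mul A').add ((hw.const_mul B').const_mul A)).const_mul P₀
  have hi₁ := hg₁.mono' hm₁.aestronglyMeasurable (Eventually.of_forall (hbound₁ ht))
  have hi₂ := hg₂.mono' hm₂.aestronglyMeasurable (Eventually.of_forall (hbound₂ ht))
  have hF (s : ℝ) : Continuous (fun x => ψ (x / lam s) * (u₁ s x * u₂ s x)) := by
    have := c₁ s
    have := c₂ s
    fun_prop
  have hFi : Integrable (fun x => ψ (x / lam t) * (u₁ t x * u₂ t x)) := by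
    refine integrable_bounded_mul (by fun_prop) ⟨P₀, fun x => hP₀ _⟩
      (integrable_bounded_mul (c₁ t) ⟨A, hA t (hball ht)⟩
        (integrable_of_one_add_abs_sq_mul_le (c₂ t) ⟨B, hB t (hball ht)⟩))
  have hderiv (x s : ℝ) : HasDerivAt (fun s => ψ (x / lam s) * (u₁ s x * u₂ s x))
      (-(deriv ψ (x / lam s) * (deriv lam s / lam s ^ 2) * u₁ s x * (x * u₂ s x))
        + ψ (x / lam s) *
          (deriv (fun r => u₁ r x) s * u₂ s x + u₁ s x * deriv (fun r => u₂ r x) s)) s := by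
    have d₁ := ((contDiff_fst_slice hu₁ x).differentiable (by simp) s).hasDerivAt
    have d₂ := ((contDiff_fst_slice hu₂ x).differentiable (by simp) s).hasDerivAt
    have dlam := (hlam.differentiable (by simp) s).hasDerivAt
    have dψ := (hψ.differentiable (by simp) (x / lam s)).hasDerivAt.comp
      (h := fun r => x / lam r) s ((hasDerivAt_const s x).div dlam (hlam0 s))
    refine (dψ.mul (d₁.mul d₂)).congr_deriv ?_
    simp only [Pi.mul_apply, Function.comp_apply]
    ring
  have key := (hasDerivAt_integral_of_dominated_loc_of_deriv_le
    (Metric.ball_mem_nhds t one_pos)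
    (Eventually.of_forall fun s => (hF s).aestronglyMeasurable) hFi
    (hm₁.neg.add hm₂).aestronglyMeasurable
    (Eventually.of_forall fun x s hs => (norm_add_le _ _).trans
      (add_le_add ((norm_neg _).trans_le (hbound₁ hs x)) (hbound₂ hs x)))
    (hg₁.add hg₂) (Eventually.of_forall fun x s _ => hderiv x s)).2
  refine key.congr_deriv ?_
  rw [integral_add hi₁.fun_neg hi₂, integral_neg, ← integral_const_mul, ← integral_neg]
  congr 1
  refine integral_congr_ae (Eventually.of_forall fun x => ?_)
  have := hlam0 t
  simp only
  field_simp

/-- Virial identity (Lemma 2.1) for the generalized Boussinesq system. -/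
theorem stmt_0 (p K : ℝ) (hp : 1 < p) (hK : 0 < K)
    (f : ℝ → ℝ) (hf : ContDiff ℝ (⊤ : ℕ∞) f) (hf0 : f 0 = 0)
    (hfp : ∀ s : ℝ, |s| ≤ 1 → |deriv f s| ≤ K * |s| ^ (p - 1))
    (u₁ u₂ : ℝ → ℝ → ℝ)
    (hu₁ : ContDiff ℝ (⊤ : ℕ∞) (fun q : ℝ × ℝ => u₁ q.1 q.2))
    (hu₂ : ContDiff ℝ (⊤ : ℕ∞) (fun q : ℝ × ℝ => u₂ q.1 q.2))
    (heq₁ : ∀ t x : ℝ, deriv (fun s => u₁ s x) t = deriv (u₂ t) x)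
    (heq₂ : ∀ t x : ℝ, deriv (fun s => u₂ s x) t
      = deriv (fun y => u₁ t y - deriv (deriv (u₁ t)) y - f (u₁ t y)) x)
    (hdec₁ : ∀ T : ℝ, ∀ m k n : ℕ, ∃ M : ℝ, ∀ t ∈ Set.Icc (-T) T, ∀ x : ℝ,
      (1 + |x|) ^ n * |iteratedDeriv k (fun y => iteratedDeriv m (fun s => u₁ s y) t) x| ≤ M)
    (hdec₂ : ∀ T : ℝ, ∀ m k n : ℕ, ∃ M : ℝ, ∀ t ∈ Set.Icc (-T) T, ∀ x : ℝ,
      (1 + |x|) ^ n * |iteratedDeriv k (fun y => iteratedDeriv m (fun s => u₂ s y) t) x| ≤ M)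
    (ψ lam : ℝ → ℝ) (hψ : ContDiff ℝ (⊤ : ℕ∞) ψ)
    (hψb : ∀ n : ℕ, ∃ M : ℝ, ∀ x : ℝ, |iteratedDeriv n ψ x| ≤ M)
    (hlam : ContDiff ℝ (⊤ : ℕ∞) lam) (hlampos : ∀ t : ℝ, 0 < lam t) :
    ∀ t : ℝ, HasDerivAt (fun s => ∫ x : ℝ, ψ (x / lam s) * (u₁ s x * u₂ s x))
      (-(deriv lam t / lam t) *
          (∫ x : ℝ, (x / lam t) * deriv ψ (x / lam t) * (u₁ t x * u₂ t x))
        - (1 / (2 * lam t)) * (∫ x : ℝ, deriv ψ (x / lam t) * (u₂ t x) ^ 2)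
        - (1 / (2 * lam t)) * (∫ x : ℝ, deriv ψ (x / lam t) * (u₁ t x) ^ 2)
        + (1 / (2 * (lam t) ^ 3)) * (∫ x : ℝ, iteratedDeriv 3 ψ (x / lam t) * (u₁ t x) ^ 2)
        - (3 / (2 * lam t)) * (∫ x : ℝ, deriv ψ (x / lam t) * (deriv (u₁ t) x) ^ 2)
        + (1 / lam t) * (∫ x : ℝ, deriv ψ (x / lam t)
            * (u₁ t x * f (u₁ t x) - ∫ r in (0:ℝ)..(u₁ t x), f r))) t := by
  intro t
  have ht : t ∈ Set.Icc (-|t|) |t| := abs_le.mp le_rfl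
  have slice {u : ℝ → ℝ → ℝ} (hu : ContDiff ℝ (⊤ : ℕ∞) (fun q : ℝ × ℝ => u q.1 q.2))
      (hdec : ∀ T : ℝ, ∀ m k n : ℕ, ∃ M : ℝ, ∀ t ∈ Set.Icc (-T) T, ∀ x : ℝ,
        (1 + |x|) ^ n * |iteratedDeriv k (fun y => iteratedDeriv m (fun s => u s y) t) x| ≤ M)
      (k : ℕ) : (∃ M, ∀ x, |iteratedDeriv k (u t) x| ≤ M) ∧ Integrable (iteratedDeriv k (u t)) := by
    obtain ⟨M, hM⟩ := hdec |t| 0 k 0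
    obtain ⟨N, hN⟩ := hdec |t| 0 k 2
    simp only [iteratedDeriv_zero] at hM hN
    refine ⟨⟨M, fun x => by simpa using hM t ht x⟩,
      integrable_of_one_add_abs_sq_mul_le ?_ ⟨N, hN t ht⟩⟩
    exact continuous_iff_continuousAt.mpr fun x =>
      (hasDerivAt_iteratedDeriv (contDiff_snd_slice hu t) k x).continuousAt
  have h := hasDerivAt_integral_scaled_weight hu₁ hu₂
    (fun T m n => by simpa only [iteratedDeriv_zero] using hdec₁ T m 0 n)
    (fun T m n => by simpa only [iteratedDeriv_zero] using hdec₂ T m 0 n)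
    hψ hψb hlam hlampos t
  simp only [heq₁, heq₂] at h
  rw [integral_virial_flux (hlampos t).ne' hψ hψb hf (contDiff_snd_slice hu₁ t)
    (contDiff_snd_slice hu₂ t) (fun k => (slice hu₁ hdec₁ k).1) (fun k => (slice hu₂ hdec₂ k).1)
    (fun k => (slice hu₁ hdec₁ k).2) (fun k => (slice hu₂ hdec₂ k).2)] at h
  refine h.congr_deriv ?_
  ring
end

section
/- Let ψ : ℝ → ℝ be smooth with all derivatives bounded, let λ > 0 be a real number, and let u : ℝ → ℝ be a Schwartz function. Then ∫_ℝ (d/dx)(ψ(x/λ) u(x)) · u''(x) dx = (1/(2λ³)) ∫_ℝ ψ'''(x/λ) u(x)² dx − (3/(2λ)) ∫_ℝ ψ'(x/λ) u'(x)² dx. -/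
open MeasureTheory

/-- A bounded continuous function times a product of two Schwartz functions is integrable. -/
lemma integrable_bdd_mul_schwartz_mul {g : ℝ → ℝ} (hg : Continuous g)
    (hb : ∃ M : ℝ, ∀ x, |g x| ≤ M) (v w : SchwartzMap ℝ ℝ) :
    Integrable (fun x => g x * (v x * w x)) := by
  obtain ⟨M, hM⟩ := hb
  have hw : Integrable (fun x => v x * w x) :=
    w.integrable.bdd_mul v.continuous.aestronglyMeasurable
      (.of_forall (v.toBoundedContinuousFunction.norm_coe_le_norm))
  exact hw.bdd_mul (c := M) hg.aestronglyMeasurable (.of_forall fun x => by simpa using hM x)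

/-- The chain rule for a rescaled iterated derivative. -/
lemma hasDerivAt_iteratedDeriv_comp_div {ψ : ℝ → ℝ} (hψ : ContDiff ℝ (⊤ : ℕ∞) ψ)
    (l : ℝ) (n : ℕ) (x : ℝ) :
    HasDerivAt (fun y => iteratedDeriv n ψ (y / l)) (iteratedDeriv (n + 1) ψ (x / l) / l) x := by
  have hd : Differentiable ℝ (iteratedDeriv n ψ) :=
    hψ.differentiable_iteratedDeriv n (by exact_mod_cast WithTop.coe_lt_top n)
  have h := (hd (x / l)).hasDerivAt.comp x ((hasDerivAt_id x).div_const l)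
  rw [iteratedDeriv_succ]
  simpa [Function.comp_def, div_eq_mul_inv] using h

/-- Integration by parts identity for the fourth-order term. -/
theorem stmt_1 (ψ : ℝ → ℝ) (hψ : ContDiff ℝ (⊤ : ℕ∞) ψ)
    (hψb : ∀ n : ℕ, ∃ M : ℝ, ∀ x : ℝ, |iteratedDeriv n ψ x| ≤ M)
    (l : ℝ) (hl : 0 < l) (u : SchwartzMap ℝ ℝ) :
    (∫ x : ℝ, deriv (fun y => ψ (y / l) * u y) x * deriv (deriv ⇑u) x)
      = (1 / (2 * l ^ 3)) * (∫ x : ℝ, iteratedDeriv 3 ψ (x / l) * (u x) ^ 2)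
        - (3 / (2 * l)) * (∫ x : ℝ, deriv ψ (x / l) * (deriv ⇑u x) ^ 2) := by
  set v : SchwartzMap ℝ ℝ := SchwartzMap.derivCLM ℝ ℝ u
  set w : SchwartzMap ℝ ℝ := SchwartzMap.derivCLM ℝ ℝ v
  have hv : deriv ⇑u = ⇑v := rfl
  have hw : deriv ⇑v = ⇑w := rfl
  have du (x : ℝ) : HasDerivAt u (v x) x := u.differentiableAt.hasDerivAt
  have dv (x : ℝ) : HasDerivAt v (w x) x := v.differentiableAt.hasDerivAt
  have dψ := hasDerivAt_iteratedDeriv_comp_div hψ l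
  have hI (n : ℕ) (f g : SchwartzMap ℝ ℝ) :
      Integrable (fun x => iteratedDeriv n ψ (x / l) * (f x * g x)) :=
    integrable_bdd_mul_schwartz_mul
      (continuous_iff_continuousAt.2 fun x => (dψ n x).continuousAt)
      ((hψb n).imp fun M hM x => hM (x / l)) f g
  have hderiv (x : ℝ) : deriv (fun y => ψ (y / l) * u y) x
      = iteratedDeriv 1 ψ (x / l) / l * u x + iteratedDeriv 0 ψ (x / l) * v x := by
    simpa using ((dψ 0 x).fun_mul (du x)).deriv
  have hA : Integrable fun x => deriv (fun y => ψ (y / l) * u y) x * w x := by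
    refine (((hI 1 u w).const_mul (1 / l)).add (hI 0 v w)).congr (.of_forall fun x => ?_)
    simp only [Pi.add_apply, hderiv]
    ring
  have hB := (hI 3 u u).const_mul (1 / (2 * l ^ 3))
  have hC := (hI 1 v v).const_mul (3 / (2 * l))
  have key := integral_eq_zero_of_hasDerivAt_of_integrable
    (f := fun x => 1 / l * (iteratedDeriv 1 ψ (x / l) * (u x * v x))
      + 1 / 2 * (iteratedDeriv 0 ψ (x / l) * (v x * v x))
      - 1 / (2 * l ^ 2) * (iteratedDeriv 2 ψ (x / l) * (u x * u x)))
    (f' := fun x => deriv (fun y => ψ (y / l) * u y) x * w x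
      - 1 / (2 * l ^ 3) * (iteratedDeriv 3 ψ (x / l) * (u x * u x))
      + 3 / (2 * l) * (iteratedDeriv 1 ψ (x / l) * (v x * v x)))
    (fun x => by
      refine HasDerivAt.congr_deriv ((((dψ 1 x).fun_mul ((du x).fun_mul (dv x))).const_mul
        (1 / l)).fun_add (((dψ 0 x).fun_mul ((dv x).fun_mul (dv x))).const_mul (1 / 2)) |>.fun_sub
        (((dψ 2 x).fun_mul ((du x).fun_mul (du x))).const_mul (1 / (2 * l ^ 2)))) ?_
      rw [hderiv]
      simp only [Nat.reduceAdd]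
      field_simp
      ring)
    ((hA.sub hB).add hC)
    ((((hI 1 u v).const_mul _).add ((hI 0 v v).const_mul _)).sub ((hI 2 u u).const_mul _))
  rw [integral_add (by exact hA.sub hB) hC, integral_sub hA hB, integral_const_mul,
    integral_const_mul] at key
  simp only [hv, hw, pow_two (u _), pow_two (v _), ← iteratedDeriv_one (f := ψ)]
  linarith
end

section
/- There exist ε₀ > 0 and A > 0, depending only on C, p, K, such that: if the smallness condition holds with some ε ≤ ε₀, then ∫₂^∞ (1/λ(t)) [∫_ℝ sech²(x/λ(t)) ((∂ₓu₁)² + u₁² + u₂²)(t,x) dx] dt ≤ A·ε². -/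
open MeasureTheory Filter

noncomputable def sech (x : ℝ) : ℝ := 1 / Real.cosh x

noncomputable def lam (C t : ℝ) : ℝ := C * t / (Real.log t) ^ 2

theorem sech_sq_eq_one_sub_tanh_sq (y : ℝ) : sech y ^ 2 = 1 - Real.tanh y ^ 2 := by
  have h := (Real.cosh_pos y).ne'
  rw [sech, Real.tanh_eq_sinh_div_cosh]
  field_simp
  linarith [Real.cosh_sq_sub_sinh_sq y]

theorem hasDerivAt_tanh_eq_sech_sq (y : ℝ) : HasDerivAt Real.tanh (sech y ^ 2) y := by
  have h := (Real.cosh_pos y).ne'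
  have hd := (Real.hasDerivAt_sinh y).div (Real.hasDerivAt_cosh y) h
  have he : Real.tanh = Real.sinh / Real.cosh := funext fun z => Real.tanh_eq_sinh_div_cosh z
  rw [he]
  refine hd.congr_deriv ?_
  simp only [sech]
  field_simp
  linarith [Real.cosh_sq_sub_sinh_sq y]

theorem continuous_tanh_real : Continuous Real.tanh :=
  continuous_iff_continuousAt.2 fun y => (hasDerivAt_tanh_eq_sech_sq y).continuousAt

theorem continuous_sech : Continuous sech :=
  continuous_const.div Real.continuous_cosh fun y => (Real.cosh_pos y).ne'

theorem hasDerivAt_sech_sq (y : ℝ) :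
    HasDerivAt (fun z => sech z ^ 2) (-2 * Real.tanh y * sech y ^ 2) y := by
  have h := ((hasDerivAt_tanh_eq_sech_sq y).pow 2).const_sub 1
  simp only [sech_sq_eq_one_sub_tanh_sq] at h ⊢
  exact h.congr_deriv (by push_cast; ring)

theorem sech_sq_le_one (y : ℝ) : sech y ^ 2 ≤ 1 := by
  linarith [sech_sq_eq_one_sub_tanh_sq y, sq_nonneg (Real.tanh y)]

theorem sq_mul_sech_sq_le_one (y : ℝ) : y ^ 2 * sech y ^ 2 ≤ 1 := by
  have hs : y ^ 2 ≤ Real.sinh y ^ 2 := by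
    rcases le_total 0 y with h | h
    · exact pow_le_pow_left₀ h (Real.self_le_sinh_iff.2 h) 2
    · have h1 := Real.sinh_le_self_iff.2 h
      nlinarith
  have h := Real.cosh_pos y
  rw [sech, div_pow, one_pow, mul_one_div, div_le_one (by positivity)]
  linarith [Real.cosh_sq y]

/-- Continuous functions that decay at least like `(1 + x ^ 2)⁻¹`. -/
def QuadDecay (v : ℝ → ℝ) : Prop :=
  Continuous v ∧ ∃ M, ∀ x, (1 + x ^ 2) * |v x| ≤ M

theorem QuadDecay.exists_abs_le {v : ℝ → ℝ} (hv : QuadDecay v) : ∃ M, ∀ x, |v x| ≤ M := by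
  obtain ⟨-, M, hM⟩ := hv
  refine ⟨M, fun x => le_trans ?_ (hM x)⟩
  nlinarith [sq_nonneg x, abs_nonneg (v x), mul_nonneg (sq_nonneg x) (abs_nonneg (v x))]

theorem QuadDecay.integrable {v : ℝ → ℝ} (hv : QuadDecay v) : Integrable v := by
  obtain ⟨hc, M, hM⟩ := hv
  refine (integrable_inv_one_add_sq.const_mul M).mono' hc.aestronglyMeasurable
    (Eventually.of_forall fun x => ?_)
  rw [Real.norm_eq_abs, ← div_eq_mul_inv, le_div_iff₀ (by positivity), mul_comm]
  exact hM x

theorem QuadDecay.continuous_mul {v w : ℝ → ℝ} (hv : QuadDecay v) (hw : Continuous w)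
    (hb : ∃ B, ∀ x, |w x| ≤ B) : QuadDecay fun x => w x * v x := by
  obtain ⟨hc, M, hM⟩ := hv
  obtain ⟨B, hB⟩ := hb
  refine ⟨hw.mul hc, B * M, fun x => ?_⟩
  calc (1 + x ^ 2) * |w x * v x| = |w x| * ((1 + x ^ 2) * |v x|) := by rw [abs_mul]; ring
    _ ≤ B * M := mul_le_mul (hB x) (hM x) (by positivity) ((abs_nonneg _).trans (hB x))

theorem QuadDecay.mul {v w : ℝ → ℝ} (hw : QuadDecay w) (hv : QuadDecay v) :
    QuadDecay fun x => w x * v x :=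
  hv.continuous_mul hw.1 hw.exists_abs_le

theorem QuadDecay.sq {v : ℝ → ℝ} (hv : QuadDecay v) : QuadDecay fun x => v x ^ 2 := by
  simpa only [pow_two] using hv.mul hv

theorem QuadDecay.add {v w : ℝ → ℝ} (hw : QuadDecay w) (hv : QuadDecay v) :
    QuadDecay fun x => w x + v x := by
  obtain ⟨hc, M, hM⟩ := hv
  obtain ⟨hd, N, hN⟩ := hw
  refine ⟨hd.add hc, N + M, fun x => ?_⟩
  calc (1 + x ^ 2) * |w x + v x| ≤ (1 + x ^ 2) * (|w x| + |v x|) := by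
        gcongr; exact abs_add_le _ _
    _ ≤ N + M := by linarith [hM x, hN x]

theorem QuadDecay.const_mul {v : ℝ → ℝ} (hv : QuadDecay v) (c : ℝ) :
    QuadDecay fun x => c * v x :=
  hv.continuous_mul continuous_const ⟨|c|, fun _ => le_rfl⟩

theorem QuadDecay.sub {v w : ℝ → ℝ} (hw : QuadDecay w) (hv : QuadDecay v) :
    QuadDecay fun x => w x - v x := by
  simpa [sub_eq_add_neg] using hw.add (hv.const_mul (-1))

theorem QuadDecay.of_abs_le {v w : ℝ → ℝ} (hv : QuadDecay v) (hw : Continuous w)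
    (h : ∀ x, |w x| ≤ |v x|) : QuadDecay w := by
  obtain ⟨-, M, hM⟩ := hv
  exact ⟨hw, M, fun x => (mul_le_mul_of_nonneg_left (h x) (by positivity)).trans (hM x)⟩

theorem QuadDecay.id_mul_mul {v w : ℝ → ℝ} (hw : QuadDecay w) (hv : QuadDecay v) :
    QuadDecay fun x => x * w x * v x := by
  obtain ⟨hd, N, hN⟩ := hw
  refine hv.continuous_mul (continuous_id.mul hd) ⟨N, fun x => le_trans ?_ (hN x)⟩
  rw [abs_mul]
  gcongr
  nlinarith [sq_abs x, sq_nonneg (|x| - 1)]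

theorem QuadDecay.tanh_mul {v : ℝ → ℝ} (hv : QuadDecay v) (m : ℝ) :
    QuadDecay fun x => Real.tanh (m * x) * v x :=
  hv.continuous_mul (continuous_tanh_real.comp (continuous_const.mul continuous_id))
    ⟨1, fun x => (Real.abs_tanh_lt_one (m * x)).le⟩

theorem QuadDecay.sech_sq_mul {v : ℝ → ℝ} (hv : QuadDecay v) (m : ℝ) :
    QuadDecay fun x => sech (m * x) ^ 2 * v x :=
  hv.continuous_mul ((continuous_sech.comp (continuous_const.mul continuous_id)).pow 2)
    ⟨1, fun x => by
      simpa only [Function.comp, abs_sq] using sech_sq_le_one (m * x)⟩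

/-- Virial inequality at a fixed time, for the weight `tanh (m * x)` moving with speed given by the
derivative of the inverse scale `m`. -/
theorem integral_virial_le {m m' : ℝ} (hm : 0 < m) {a a₁ a₂ a₃ b b₁ n g : ℝ → ℝ}
    (ha : QuadDecay a) (ha₁ : QuadDecay a₁) (ha₂ : QuadDecay a₂) (hb : QuadDecay b)
    (hda : ∀ x, HasDerivAt a (a₁ x) x) (hda₁ : ∀ x, HasDerivAt a₁ (a₂ x) x)
    (hda₂ : ∀ x, HasDerivAt a₂ (a₃ x) x) (hdb : ∀ x, HasDerivAt b (b₁ x) x)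
    (hdg : ∀ x, HasDerivAt g (a x * n x) x) (hg : ∀ x, |g x| ≤ 1 / 4 * a x ^ 2)
    (hint : Integrable fun x => m' * x * sech (m * x) ^ 2 * (a x * b x)
      + Real.tanh (m * x) * (b₁ x * b x + a x * (a₁ x - a₃ x - n x))) :
    ∫ x, (m' * x * sech (m * x) ^ 2 * (a x * b x)
      + Real.tanh (m * x) * (b₁ x * b x + a x * (a₁ x - a₃ x - n x)))
    ≤ -(1 / 4) * (m * ∫ x, sech (m * x) ^ 2 * (a₁ x ^ 2 + a x ^ 2 + b x ^ 2))
      + (2 * m ^ 3 + m' ^ 2 / m ^ 3) * ∫ x, a x ^ 2 := by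
  have hgd : QuadDecay g :=
    (ha.sq.const_mul (1 / 4)).of_abs_le
      (continuous_iff_continuousAt.2 fun x => (hdg x).continuousAt)
      fun x => (hg x).trans (le_abs_self _)
  let R : ℝ → ℝ := fun x => m' * (sech (m * x) ^ 2 * (x * a x * b x))
    - m * (sech (m * x) ^ 2 *
        (1 / 2 * b x ^ 2 + 1 / 2 * a x ^ 2 + 3 / 2 * a₁ x ^ 2 - g x))
    + 2 * m ^ 2 * (Real.tanh (m * x) * (sech (m * x) ^ 2 * (a x * a₁ x)))
  let H : ℝ → ℝ := fun x => Real.tanh (m * x) *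
      (1 / 2 * b x ^ 2 + 1 / 2 * a x ^ 2 - a x * a₂ x + 1 / 2 * a₁ x ^ 2 - g x)
    + m * (sech (m * x) ^ 2 * (a x * a₁ x))
  have hR : Integrable R := by
    refine QuadDecay.integrable (QuadDecay.add (QuadDecay.sub ?_ ?_) ?_)
    · exact ((ha.id_mul_mul hb).sech_sq_mul m).const_mul m'
    · exact (((((hb.sq.const_mul _).add (ha.sq.const_mul _)).add
        (ha₁.sq.const_mul _)).sub hgd).sech_sq_mul m).const_mul m
    · exact (((ha.mul ha₁).sech_sq_mul m).tanh_mul m).const_mul _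
  have hH : Integrable H := by
    refine QuadDecay.integrable (QuadDecay.add ?_ ?_)
    · exact (((((hb.sq.const_mul _).add (ha.sq.const_mul _)).sub (ha.mul ha₂)).add
        (ha₁.sq.const_mul _)).sub hgd).tanh_mul m
    · exact ((ha.mul ha₁).sech_sq_mul m).const_mul m
  have hdH : ∀ x, HasDerivAt H ((m' * x * sech (m * x) ^ 2 * (a x * b x)
      + Real.tanh (m * x) * (b₁ x * b x + a x * (a₁ x - a₃ x - n x))) - R x) x := by
    intro x
    have hlin : HasDerivAt (fun y => m * y) m x := by simpa using (hasDerivAt_id x).const_mul m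
    have hT := (hasDerivAt_tanh_eq_sech_sq (m * x)).comp x hlin
    have hS := (hasDerivAt_sech_sq (m * x)).comp x hlin
    have h := (hT.mul (((((((hdb x).pow 2).const_mul (1 / 2)).add
      (((hda x).pow 2).const_mul (1 / 2))).sub ((hda x).mul (hda₂ x))).add
      (((hda₁ x).pow 2).const_mul (1 / 2))).sub (hdg x))).add
      ((hS.mul ((hda x).mul (hda₁ x))).const_mul m)
    refine h.congr_deriv ?_
    simp only [R, Function.comp, Pi.add_apply, Pi.sub_apply, Pi.mul_apply, Pi.pow_apply]
    push_cast
    ring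
  have hzero := integral_eq_zero_of_hasDerivAt_of_integrable hdH (hint.sub hR) hH
  rw [integral_sub hint hR, sub_eq_zero] at hzero
  rw [hzero]
  have hq : Integrable fun x => sech (m * x) ^ 2 * (a₁ x ^ 2 + a x ^ 2 + b x ^ 2) :=
    (((ha₁.sq.add ha.sq).add hb.sq).sech_sq_mul m).integrable
  rw [← integral_const_mul, ← integral_const_mul, ← integral_const_mul,
    ← integral_add ((hq.const_mul m).const_mul _) (ha.sq.integrable.const_mul _)]
  refine integral_mono hR (((hq.const_mul m).const_mul _).add (ha.sq.integrable.const_mul _))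
    fun x => ?_
  have hS0 := sq_nonneg (sech (m * x))
  have hS1 := sech_sq_le_one (m * x)
  have hyS := sq_mul_sech_sq_le_one (m * x)
  have hT := abs_le.1 ((Real.abs_tanh_lt_one (m * x)).le)
  have hgx := abs_le.1 (hg x)
  simp only [R]
  generalize Real.tanh (m * x) = T at *
  generalize sech (m * x) ^ 2 = S at *
  generalize a x = a at *
  generalize b x = b at *
  generalize a₁ x = c at *
  have hdrift : m' * (S * (x * a * b)) ≤ 1 / 4 * (m * (S * b ^ 2)) + m' ^ 2 / m ^ 3 * a ^ 2 := by
    have h1 : 1 / 4 * (m * (S * b ^ 2)) + m' ^ 2 / m * (S * (x * a) ^ 2)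
        - m' * (S * (x * a * b)) = S / m * (1 / 2 * (m * b) - m' * (x * a)) ^ 2 := by
      field_simp
      ring
    have h2 : m' ^ 2 / m * (S * (x * a) ^ 2) = m' ^ 2 / m ^ 3 * a ^ 2 * ((m * x) ^ 2 * S) := by
      field_simp
    have h3 : m' ^ 2 / m ^ 3 * a ^ 2 * ((m * x) ^ 2 * S) ≤ m' ^ 2 / m ^ 3 * a ^ 2 * 1 := by
      gcongr
    have h4 : 0 ≤ S / m * (1 / 2 * (m * b) - m' * (x * a)) ^ 2 := by positivity
    linarith
  have hcross : 2 * m ^ 2 * (T * (S * (a * c)))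
      ≤ 1 / 2 * (m * (S * c ^ 2)) + 2 * m ^ 3 * a ^ 2 := by
    have h1 : 0 ≤ m * S * (2 * m ^ 2 * a ^ 2 + 1 / 2 * c ^ 2 - 2 * m * (T * (a * c))) := by
      refine mul_nonneg (by positivity) ?_
      have h2 : T ^ 2 ≤ 1 := (sq_le_one_iff_abs_le_one T).2 (abs_le.2 hT)
      have h3 : T ^ 2 * c ^ 2 ≤ 1 * c ^ 2 := by gcongr
      nlinarith [sq_nonneg (2 * m * a - T * c)]
    have h2 : S * (2 * m ^ 3 * a ^ 2) ≤ 1 * (2 * m ^ 3 * a ^ 2) := by gcongr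
    linarith
  have hnl : m * (S * g x) ≤ m * (S * (1 / 4 * a ^ 2)) := by
    gcongr
    exact hgx.2
  have hc : 0 ≤ m * (S * c ^ 2) := by positivity
  linarith

theorem exists_primitive_mul_deriv {f : ℝ → ℝ} (hf : ContDiff ℝ (⊤ : ℕ∞) f) {ε : ℝ}
    (hfε : ∀ s, |s| ≤ ε → |deriv f s| ≤ 1 / 4) :
    ∃ G : ℝ → ℝ, (∀ s, HasDerivAt G (s * deriv f s) s) ∧
      ∀ s, |s| ≤ ε → |G s| ≤ 1 / 4 * s ^ 2 := by
  have hc : Continuous fun r => r * deriv f r :=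
    continuous_id.mul (hf.continuous_deriv (by simp))
  refine ⟨fun s => ∫ r in (0 : ℝ)..s, r * deriv f r, fun s =>
    intervalIntegral.integral_hasDerivAt_right (hc.intervalIntegrable _ _)
      hc.stronglyMeasurable.stronglyMeasurableAtFilter hc.continuousAt, fun s hs => ?_⟩
  have h : ∀ r ∈ Set.uIoc 0 s, ‖r * deriv f r‖ ≤ |s| * (1 / 4) := by
    intro r hr
    have hrs : |r| ≤ |s| := by
      have := Set.abs_sub_left_of_mem_uIcc (Set.uIoc_subset_uIcc hr)
      simpa using this
    rw [Real.norm_eq_abs, abs_mul]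
    exact mul_le_mul hrs (hfε r (hrs.trans hs)) (abs_nonneg _) (abs_nonneg _)
  refine (intervalIntegral.norm_integral_le_of_norm_le_const h).trans_eq ?_
  rw [sub_zero, ← sq_abs s]
  ring

theorem exists_smallness_threshold {p K : ℝ} (hp : 1 < p) (hK : 0 < K) :
    ∃ ε₀ > (0 : ℝ), ∀ (f : ℝ → ℝ), (∀ s : ℝ, |s| ≤ 1 → |deriv f s| ≤ K * |s| ^ (p - 1)) →
      ∀ s, |s| ≤ ε₀ → |deriv f s| ≤ 1 / 4 := by
  have hp' : 0 < p - 1 := by linarith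
  have hB : 0 < 1 / (4 * K) := by positivity
  refine ⟨min 1 ((1 / (4 * K)) ^ (1 / (p - 1))),
    lt_min one_pos (Real.rpow_pos_of_pos hB _), fun f hf s hs => ?_⟩
  refine (hf s (hs.trans (min_le_left _ _))).trans ?_
  have h : |s| ^ (p - 1) ≤ 1 / (4 * K) := by
    refine (Real.rpow_le_rpow (abs_nonneg s) (hs.trans (min_le_right _ _)) hp'.le).trans_eq ?_
    rw [← Real.rpow_mul hB.le, one_div_mul_cancel hp'.ne', Real.rpow_one]
  calc K * |s| ^ (p - 1) ≤ K * (1 / (4 * K)) := by gcongr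
    _ = 1 / 4 := by field_simp

/-- Derivative of the inverse scale `t ↦ 1 / lam C t`. -/
noncomputable def invLamDeriv (C t : ℝ) : ℝ := (2 * Real.log t - Real.log t ^ 2) / (C * t ^ 2)

theorem hasDerivAt_one_div_lam {C t : ℝ} (hC : 0 < C) (ht : 1 < t) :
    HasDerivAt (fun s => 1 / lam C s) (invLamDeriv C t) t := by
  have ht0 : t ≠ 0 := by positivity
  have h := ((Real.hasDerivAt_log ht0).pow 2).div ((hasDerivAt_id t).const_mul C)
    (mul_ne_zero hC.ne' ht0)
  simp only [lam, one_div_div]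
  refine h.congr_deriv ?_
  simp only [invLamDeriv, id_eq, Pi.pow_apply]
  field_simp
  push_cast
  ring

theorem lam_pos {C t : ℝ} (hC : 0 < C) (ht : 1 < t) : 0 < lam C t := by
  have := Real.log_pos ht
  rw [lam]
  positivity

theorem abs_invLamDeriv_le {C t : ℝ} (hC : 0 < C) (ht : 1 < t) : |invLamDeriv C t| ≤ 3 / C := by
  have hL := Real.log_pos ht
  have hLt : Real.log t ≤ t := by linarith [Real.log_le_sub_one_of_pos (zero_lt_one.trans ht)]
  rw [invLamDeriv, abs_div, abs_of_pos (by positivity : 0 < C * t ^ 2),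
    div_le_div_iff₀ (by positivity) hC]
  have h : |2 * Real.log t - Real.log t ^ 2| ≤ 3 * t ^ 2 := by
    rw [abs_le]
    constructor <;> nlinarith
  nlinarith

theorem log_pow_eight_le {t : ℝ} (ht : 1 < t) : Real.log t ^ 8 ≤ 4 ^ 8 * t ^ 2 := by
  have ht0 : 0 < t := by linarith
  have h : Real.log t ≤ 4 * t ^ (1 / 4 : ℝ) := by
    have := Real.log_le_rpow_div ht0.le (ε := 1 / 4) (by norm_num)
    linarith
  calc Real.log t ^ 8 ≤ (4 * t ^ (1 / 4 : ℝ)) ^ 8 :=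
        pow_le_pow_left₀ (Real.log_pos ht).le h 8
    _ = 4 ^ 8 * t ^ 2 := by
      rw [mul_pow, ← Real.rpow_natCast (t ^ (1 / 4 : ℝ)) 8, ← Real.rpow_mul ht0.le,
        ← Real.rpow_natCast t 2]
      norm_num

theorem virial_error_le {C t : ℝ} (hC : 0 < C) (ht : 2 ≤ t) :
    2 * (1 / lam C t) ^ 3 + invLamDeriv C t ^ 2 / (1 / lam C t) ^ 3
      ≤ (2 * 4 ^ 8 / C ^ 3 + 16 * C) * (t⁻¹ / Real.log t ^ 2) := by
  have ht0 : 0 < t := by linarith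
  have hL : 1 / 2 < Real.log t := by
    have := Real.log_le_log two_pos ht
    linarith [Real.log_two_gt_d9]
  have hL8 := log_pow_eight_le (by linarith : 1 < t)
  simp only [lam, invLamDeriv]
  generalize Real.log t = L at *
  have hL0 : 0 < L := by linarith
  have h1 : 2 * (1 / (C * t / L ^ 2)) ^ 3 = 2 / C ^ 3 * (L ^ 8 / t ^ 2) * (t⁻¹ / L ^ 2) := by
    field_simp
  have h2 : ((2 * L - L ^ 2) / (C * t ^ 2)) ^ 2 / (1 / (C * t / L ^ 2)) ^ 3
      = C * ((2 - L) / L) ^ 2 * (t⁻¹ / L ^ 2) := by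
    field_simp
  have h3 : L ^ 8 / t ^ 2 ≤ 4 ^ 8 := by rwa [div_le_iff₀ (by positivity)]
  have h4 : ((2 - L) / L) ^ 2 ≤ 16 := by
    rw [div_pow, div_le_iff₀ (by positivity)]
    nlinarith
  rw [h1, h2, ← add_mul]
  refine mul_le_mul_of_nonneg_right ?_ (by positivity)
  calc 2 / C ^ 3 * (L ^ 8 / t ^ 2) + C * ((2 - L) / L) ^ 2
      ≤ 2 / C ^ 3 * 4 ^ 8 + C * 16 := by gcongr
    _ = 2 * 4 ^ 8 / C ^ 3 + 16 * C := by ring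

/-- Quadratic decay in space, locally uniform in time. -/
def UniformQuadDecay (v : ℝ → ℝ → ℝ) : Prop :=
  ∀ T : ℝ, ∃ M, ∀ t ∈ Set.Icc (-T) T, ∀ x, (1 + x ^ 2) * |v t x| ≤ M

theorem UniformQuadDecay.quadDecay {v : ℝ → ℝ → ℝ} (hv : UniformQuadDecay v)
    {t : ℝ} (hc : Continuous (v t)) : QuadDecay (v t) := by
  obtain ⟨M, hM⟩ := hv |t|
  exact ⟨hc, M, hM t ⟨neg_abs_le t, le_abs_self t⟩⟩

theorem hasDerivAt_integral_virial {u v ut vt : ℝ → ℝ → ℝ} {μ μ' : ℝ → ℝ} {B t : ℝ} (ht : 1 < t)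
    (hμ : ∀ s, 1 < s → HasDerivAt μ (μ' s) s) (hμ' : ∀ s, 1 < s → |μ' s| ≤ B)
    (hut : ∀ s x, HasDerivAt (fun r => u r x) (ut s x) s)
    (hvt : ∀ s x, HasDerivAt (fun r => v r x) (vt s x) s)
    (hcu : ∀ s, Continuous (u s)) (hcv : ∀ s, Continuous (v s))
    (hcut : ∀ s, Continuous (ut s)) (hcvt : ∀ s, Continuous (vt s))
    (hu : UniformQuadDecay u) (hv : UniformQuadDecay v)
    (hdut : UniformQuadDecay ut) (hdvt : UniformQuadDecay vt) :
    Integrable (fun x => μ' t * x * sech (μ t * x) ^ 2 * (u t x * v t x)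
        + Real.tanh (μ t * x) * (ut t x * v t x + u t x * vt t x)) ∧
      HasDerivAt (fun s => ∫ x, Real.tanh (μ s * x) * (u s x * v s x))
        (∫ x, (μ' t * x * sech (μ t * x) ^ 2 * (u t x * v t x)
          + Real.tanh (μ t * x) * (ut t x * v t x + u t x * vt t x))) t := by
  obtain ⟨M₁, hM₁⟩ := hu (t + 1)
  obtain ⟨M₂, hM₂⟩ := hv (t + 1)
  obtain ⟨M₃, hM₃⟩ := hdut (t + 1)
  obtain ⟨M₄, hM₄⟩ := hdvt (t + 1)
  refine hasDerivAt_integral_of_dominated_loc_of_deriv_le (μ := volume) (x₀ := t)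
    (F := fun s x => Real.tanh (μ s * x) * (u s x * v s x))
    (F' := fun s x => μ' s * x * sech (μ s * x) ^ 2 * (u s x * v s x)
      + Real.tanh (μ s * x) * (ut s x * v s x + u s x * vt s x))
    (bound := fun x => (B * M₁ * M₂ + (M₃ * M₂ + M₁ * M₄)) * (1 + x ^ 2)⁻¹)
    (Ioo_mem_nhds ht (lt_add_one t)) ?_ ?_ ?_ ?_ (integrable_inv_one_add_sq.const_mul _) ?_
  · refine Eventually.of_forall fun s => Continuous.aestronglyMeasurable ?_
    exact (continuous_tanh_real.comp (continuous_const.mul continuous_id)).mul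
      ((hcu s).mul (hcv s))
  · exact (((hu.quadDecay (hcu t)).mul (hv.quadDecay (hcv t))).tanh_mul (μ t)).integrable
  · refine Continuous.aestronglyMeasurable ?_
    exact ((continuous_const.mul continuous_id).mul
      ((continuous_sech.comp (continuous_const.mul continuous_id)).pow 2)).mul
        ((hcu t).mul (hcv t)) |>.add
      ((continuous_tanh_real.comp (continuous_const.mul continuous_id)).mul
        (((hcut t).mul (hcv t)).add ((hcu t).mul (hcvt t))))
  · refine Eventually.of_forall fun x s hs => ?_
    have hsT : s ∈ Set.Icc (-(t + 1)) (t + 1) := ⟨by linarith [hs.1], hs.2.le⟩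
    have h1 := hM₁ s hsT x
    have h2 := hM₂ s hsT x
    have h3 := hM₃ s hsT x
    have h4 := hM₄ s hsT x
    have hb := hμ' s hs.1
    have hS := sech_sq_le_one (μ s * x)
    have hT := (Real.abs_tanh_lt_one (μ s * x)).le
    have hx1 : (1 : ℝ) ≤ 1 + x ^ 2 := by linarith [sq_nonneg x]
    have hx2 : |x| ≤ 1 + x ^ 2 := by nlinarith [sq_abs x, sq_nonneg (|x| - 1)]
    have hle : ∀ y : ℝ, |y| ≤ (1 + x ^ 2) * |y| := fun y =>
      le_mul_of_one_le_left (abs_nonneg y) hx1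
    have hM₁0 : 0 ≤ M₁ := le_trans (by positivity) h1
    have hM₃0 : 0 ≤ M₃ := le_trans (by positivity) h3
    have hB0 : 0 ≤ B := (abs_nonneg _).trans hb
    rw [Real.norm_eq_abs, ← div_eq_mul_inv, le_div_iff₀ (by positivity)]
    have hdrift : |μ' s * x * sech (μ s * x) ^ 2 * (u s x * v s x)| * (1 + x ^ 2)
        ≤ B * M₁ * M₂ := by
      calc |μ' s * x * sech (μ s * x) ^ 2 * (u s x * v s x)| * (1 + x ^ 2)
          = |μ' s| * (sech (μ s * x) ^ 2) * (|x| * |u s x|) * ((1 + x ^ 2) * |v s x|) := by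
            rw [abs_mul, abs_mul, abs_mul, abs_mul (u s x), abs_of_nonneg (sq_nonneg (sech _))]
            ring
        _ ≤ B * 1 * M₁ * M₂ := by
            gcongr
            exact (mul_le_mul_of_nonneg_right hx2 (abs_nonneg _)).trans h1
        _ = B * M₁ * M₂ := by ring
    have hflux : |Real.tanh (μ s * x) * (ut s x * v s x + u s x * vt s x)| * (1 + x ^ 2)
        ≤ M₃ * M₂ + M₁ * M₄ := by
      calc |Real.tanh (μ s * x) * (ut s x * v s x + u s x * vt s x)| * (1 + x ^ 2)
          ≤ 1 * (|ut s x| * |v s x| + |u s x| * |vt s x|) * (1 + x ^ 2) := by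
            rw [abs_mul, ← abs_mul (ut s x), ← abs_mul (u s x)]
            gcongr
            exact abs_add_le _ _
        _ = |ut s x| * ((1 + x ^ 2) * |v s x|) + |u s x| * ((1 + x ^ 2) * |vt s x|) := by ring
        _ ≤ M₃ * M₂ + M₁ * M₄ := by
            gcongr
            · exact (hle _).trans h3
            · exact (hle _).trans h1
    calc _ ≤ (|μ' s * x * sech (μ s * x) ^ 2 * (u s x * v s x)|
          + |Real.tanh (μ s * x) * (ut s x * v s x + u s x * vt s x)|) * (1 + x ^ 2) := by
          gcongr
          exact abs_add_le _ _
      _ ≤ _ := by linarith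
  · refine Eventually.of_forall fun x s hs => ?_
    have hT := (hasDerivAt_tanh_eq_sech_sq (μ s * x)).comp s ((hμ s hs.1).mul_const x)
    refine (hT.mul ((hut s x).mul (hvt s x))).congr_deriv ?_
    simp only [Function.comp, Pi.mul_apply]
    ring

theorem setIntegral_Ioi_le_of_hasDerivAt {φ g g' : ℝ → ℝ} {c B : ℝ} (hB : 0 ≤ B)
    (hg : ∀ t, c ≤ t → HasDerivAt g (g' t) t) (hφ : ∀ t, c ≤ t → φ t ≤ g' t)
    (hgB : ∀ t, c ≤ t → g t - g c ≤ B) : ∫ t in Set.Ioi c, φ t ≤ B := by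
  by_cases hint : IntegrableOn φ (Set.Ioi c)
  · refine le_of_tendsto (intervalIntegral_tendsto_integral_Ioi c hint tendsto_id) ?_
    filter_upwards [eventually_ge_atTop c] with T hT
    refine le_trans ?_ (hgB T hT)
    refine intervalIntegral.integral_le_sub_of_hasDeriv_right_of_le hT
      (fun t ht => (hg t ht.1).continuousAt.continuousWithinAt)
      (fun t ht => (hg t ht.1.le).hasDerivWithinAt) ?_ fun t ht => hφ t ht.1.le
    rw [integrableOn_Icc_iff_integrableOn_Ioc]
    exact hint.mono_set Set.Ioc_subset_Ioi_self
  · rwa [integral_undef hint]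

theorem uniformQuadDecay_of_one_add_abs_sq {v : ℝ → ℝ → ℝ}
    (h : ∀ T : ℝ, ∃ M, ∀ t ∈ Set.Icc (-T) T, ∀ x, (1 + |x|) ^ 2 * |v t x| ≤ M) :
    UniformQuadDecay v := fun T => by
  obtain ⟨M, hM⟩ := h T
  refine ⟨M, fun t ht x => le_trans ?_ (hM t ht x)⟩
  gcongr
  nlinarith [sq_abs x, abs_nonneg x]

theorem abs_integral_tanh_mul_le {m ε : ℝ} {a b : ℝ → ℝ} (ha : QuadDecay a) (hb : QuadDecay b)
    (haε : ∫ x, a x ^ 2 ≤ ε ^ 2) (hbε : ∫ x, b x ^ 2 ≤ ε ^ 2) :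
    |∫ x, Real.tanh (m * x) * (a x * b x)| ≤ ε ^ 2 := by
  have h : ‖∫ x, Real.tanh (m * x) * (a x * b x)‖ ≤ ∫ x, (1 / 2 * a x ^ 2 + 1 / 2 * b x ^ 2) := by
    refine norm_integral_le_of_norm_le
      ((ha.sq.integrable.const_mul _).add (hb.sq.integrable.const_mul _))
      (Eventually.of_forall fun x => ?_)
    rw [Real.norm_eq_abs, abs_mul]
    calc |Real.tanh (m * x)| * |a x * b x| ≤ 1 * |a x * b x| := by
          gcongr
          exact (Real.abs_tanh_lt_one _).le
      _ ≤ 1 / 2 * a x ^ 2 + 1 / 2 * b x ^ 2 := by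
          rw [one_mul, abs_mul, ← sq_abs (a x), ← sq_abs (b x)]
          linarith [two_mul_le_add_sq |a x| |b x|]
  rw [integral_add (ha.sq.integrable.const_mul _) (hb.sq.integrable.const_mul _),
    integral_const_mul, integral_const_mul, Real.norm_eq_abs] at h
  linarith

/-- Integrated Virial estimate \eqref{Integration}. -/
theorem stmt_5 (C p K : ℝ) (hC : 0 < C) (hp : 1 < p) (hK : 0 < K) :
    ∃ ε₀ > (0:ℝ), ∃ A > (0:ℝ),
    ∀ (f : ℝ → ℝ) (u₁ u₂ : ℝ → ℝ → ℝ),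
      ContDiff ℝ (⊤ : ℕ∞) f → f 0 = 0 →
      (∀ s : ℝ, |s| ≤ 1 → |deriv f s| ≤ K * |s| ^ (p - 1)) →
      ContDiff ℝ (⊤ : ℕ∞) (fun q : ℝ × ℝ => u₁ q.1 q.2) →
      ContDiff ℝ (⊤ : ℕ∞) (fun q : ℝ × ℝ => u₂ q.1 q.2) →
      (∀ t x : ℝ, deriv (fun s => u₁ s x) t = deriv (u₂ t) x) →
      (∀ t x : ℝ, deriv (fun s => u₂ s x) t
        = deriv (fun y => u₁ t y - deriv (deriv (u₁ t)) y - f (u₁ t y)) x) →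
      (∀ T : ℝ, ∀ m k n : ℕ, ∃ M : ℝ, ∀ t ∈ Set.Icc (-T) T, ∀ x : ℝ,
        (1 + |x|) ^ n * |iteratedDeriv k (fun y => iteratedDeriv m (fun s => u₁ s y) t) x| ≤ M) →
      (∀ T : ℝ, ∀ m k n : ℕ, ∃ M : ℝ, ∀ t ∈ Set.Icc (-T) T, ∀ x : ℝ,
        (1 + |x|) ^ n * |iteratedDeriv k (fun y => iteratedDeriv m (fun s => u₂ s y) t) x| ≤ M) →
      ∀ ε : ℝ, 0 < ε → ε ≤ ε₀ →
      (∀ t : ℝ, 2 ≤ t →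
        Real.sqrt (∫ x : ℝ, ((u₁ t x) ^ 2 + (deriv (u₁ t) x) ^ 2))
          + Real.sqrt (∫ x : ℝ, (u₂ t x) ^ 2) + (⨆ x : ℝ, |u₁ t x|) ≤ ε) →
      (∫ t in Set.Ioi (2:ℝ), (1 / lam C t) *
          ∫ x : ℝ, sech (x / lam C t) ^ 2 *
            ((deriv (u₁ t) x) ^ 2 + (u₁ t x) ^ 2 + (u₂ t x) ^ 2))
        ≤ A * ε ^ 2 := by
  obtain ⟨ε₀, hε₀, hthr⟩ := exists_smallness_threshold hp hK
  set A₁ : ℝ := 2 * 4 ^ 8 / C ^ 3 + 16 * C with hA₁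
  have hA₁0 : 0 < A₁ := by positivity
  refine ⟨ε₀, hε₀, 8 + 8 * A₁, by positivity, ?_⟩
  intro f u₁ u₂ hf _ hfK hu₁ hu₂ heq₁ heq₂ hdec₁ hdec₂ ε hε hεε₀ hsmall
  have hfε : ∀ s, |s| ≤ ε → |deriv f s| ≤ 1 / 4 := fun s hs => hthr f hfK s (hs.trans hεε₀)
  obtain ⟨G, hG, hGε⟩ := exists_primitive_mul_deriv hf hfε
  have hx₁ : ∀ t, ContDiff ℝ (⊤ : ℕ∞) (u₁ t) := fun t =>
    hu₁.comp (contDiff_const.prodMk contDiff_id)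
  have hx₂ : ∀ t, ContDiff ℝ (⊤ : ℕ∞) (u₂ t) := fun t =>
    hu₂.comp (contDiff_const.prodMk contDiff_id)
  have ht₁ : ∀ x, ContDiff ℝ (⊤ : ℕ∞) (fun s => u₁ s x) := fun x =>
    hu₁.comp (contDiff_id.prodMk contDiff_const)
  have ht₂ : ∀ x, ContDiff ℝ (⊤ : ℕ∞) (fun s => u₂ s x) := fun x =>
    hu₂.comp (contDiff_id.prodMk contDiff_const)
  have hx₁' : ∀ t, ContDiff ℝ (⊤ : ℕ∞) (deriv (u₁ t)) := fun t =>
    (contDiff_infty_iff_deriv.1 (hx₁ t)).2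
  have hx₁'' : ∀ t, ContDiff ℝ (⊤ : ℕ∞) (deriv (deriv (u₁ t))) := fun t =>
    (contDiff_infty_iff_deriv.1 (hx₁' t)).2
  have hdiff : ∀ {v : ℝ → ℝ}, ContDiff ℝ (⊤ : ℕ∞) v → ∀ x, HasDerivAt v (deriv v x) x :=
    fun hv x => ((contDiff_infty_iff_deriv.1 hv).1 x).hasDerivAt
  have hflux : ∀ t x, deriv (fun s => u₂ s x) t
      = deriv (u₁ t) x - deriv (deriv (deriv (u₁ t))) x - deriv f (u₁ t x) * deriv (u₁ t) x :=
    fun t x => (heq₂ t x).trans (((hdiff (hx₁ t) x).sub (hdiff (hx₁'' t) x)).sub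
      ((hdiff hf (u₁ t x)).comp x (hdiff (hx₁ t) x))).deriv
  have hcut : ∀ t, Continuous fun x => deriv (fun s => u₁ s x) t := fun t => by
    simp only [heq₁]
    exact (contDiff_infty_iff_deriv.1 (hx₂ t)).2.continuous
  have hcvt : ∀ t, Continuous fun x => deriv (fun s => u₂ s x) t := fun t => by
    simp only [heq₂]
    exact (contDiff_infty_iff_deriv.1
      (((hx₁ t).sub (hx₁'' t)).sub (hf.comp (hx₁ t)))).2.continuous
  have hdu : UniformQuadDecay u₁ := uniformQuadDecay_of_one_add_abs_sq fun T => by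
    simpa using hdec₁ T 0 0 2
  have hdv : UniformQuadDecay u₂ := uniformQuadDecay_of_one_add_abs_sq fun T => by
    simpa using hdec₂ T 0 0 2
  have hdux : UniformQuadDecay fun t => deriv (u₁ t) :=
    uniformQuadDecay_of_one_add_abs_sq fun T => by simpa using hdec₁ T 0 1 2
  have hduxx : UniformQuadDecay fun t => deriv (deriv (u₁ t)) :=
    uniformQuadDecay_of_one_add_abs_sq fun T => by
      simpa [iteratedDeriv_succ] using hdec₁ T 0 2 2
  have hdut : UniformQuadDecay fun t x => deriv (fun s => u₁ s x) t :=
    uniformQuadDecay_of_one_add_abs_sq fun T => by simpa using hdec₁ T 1 0 2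
  have hdvt : UniformQuadDecay fun t x => deriv (fun s => u₂ s x) t :=
    uniformQuadDecay_of_one_add_abs_sq fun T => by simpa using hdec₂ T 1 0 2
  have hqu : ∀ t, QuadDecay (u₁ t) := fun t => hdu.quadDecay (hx₁ t).continuous
  have hqv : ∀ t, QuadDecay (u₂ t) := fun t => hdv.quadDecay (hx₂ t).continuous
  have hqux : ∀ t, QuadDecay (deriv (u₁ t)) := fun t => hdux.quadDecay (hx₁' t).continuous
  have hquxx : ∀ t, QuadDecay (deriv (deriv (u₁ t))) := fun t =>
    hduxx.quadDecay (hx₁'' t).continuous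
  have hbounds : ∀ t, 2 ≤ t → ∫ x, u₁ t x ^ 2 ≤ ε ^ 2 ∧ ∫ x, u₂ t x ^ 2 ≤ ε ^ 2 ∧
      ∀ x, |u₁ t x| ≤ ε := by
    intro t ht
    have h := hsmall t ht
    have h₁ := Real.sqrt_nonneg (∫ x, (u₁ t x ^ 2 + deriv (u₁ t) x ^ 2))
    have h₂ := Real.sqrt_nonneg (∫ x, u₂ t x ^ 2)
    have h₃ : 0 ≤ ⨆ x, |u₁ t x| := Real.iSup_nonneg fun x => abs_nonneg _
    refine ⟨?_, (Real.sqrt_le_iff.1 (by linarith)).2, fun x => ?_⟩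
    · have h₄ : √(∫ x, (u₁ t x ^ 2 + deriv (u₁ t) x ^ 2)) ≤ ε := by linarith
      refine le_trans ?_ (Real.sqrt_le_iff.1 h₄).2
      exact integral_mono (hqu t).sq.integrable ((hqu t).sq.add (hqux t).sq).integrable
        fun x => le_add_of_nonneg_right (sq_nonneg _)
    · obtain ⟨M, hM⟩ := (hqu t).exists_abs_le
      have : |u₁ t x| ≤ ⨆ y, |u₁ t y| := le_ciSup ⟨M, Set.forall_mem_range.2 hM⟩ x
      linarith
  have hI : ∀ t : ℝ, 2 ≤ t → _ := fun t ht =>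
    hasDerivAt_integral_virial (by linarith : 1 < t) (fun s hs => hasDerivAt_one_div_lam hC hs)
      (fun s hs => abs_invLamDeriv_le hC hs) (fun s x => hdiff (ht₁ x) s)
      (fun s x => hdiff (ht₂ x) s) (fun s => (hx₁ s).continuous) (fun s => (hx₂ s).continuous)
      hcut hcvt hdu hdv hdut hdvt
  have hlog : ∀ t, 2 ≤ t → HasDerivAt (fun s => (Real.log s)⁻¹) (-t⁻¹ / Real.log t ^ 2) t :=
    fun t ht => Real.hasDerivAt_inv_log (by linarith) (by linarith) (by linarith)
  refine setIntegral_Ioi_le_of_hasDerivAt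
    (g := fun t => -4 * (∫ x, Real.tanh (1 / lam C t * x) * (u₁ t x * u₂ t x))
      - 4 * A₁ * ε ^ 2 * (Real.log t)⁻¹) (by positivity)
    (fun t ht => ((hI t ht).2.const_mul (-4)).sub ((hlog t ht).const_mul (4 * A₁ * ε ^ 2)))
    (fun t ht => ?_) fun t ht => ?_
  · obtain ⟨hb₁, -, hb₃⟩ := hbounds t ht
    have hint := (hI t ht).1
    have hm : 0 < 1 / lam C t := one_div_pos.2 (lam_pos hC (by linarith))
    simp only [heq₁, hflux] at hint ⊢
    have hvir := integral_virial_le hm (hqu t) (hqux t) (hquxx t) (hqv t) (hdiff (hx₁ t))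
      (hdiff (hx₁' t)) (hdiff (hx₁'' t)) (hdiff (hx₂ t))
      (n := fun x => deriv f (u₁ t x) * deriv (u₁ t) x) (g := fun x => G (u₁ t x))
      (fun x => ((hG (u₁ t x)).comp x (hdiff (hx₁ t) x)).congr_deriv (by ring))
      (fun x => hGε _ (hb₃ x)) hint
    have herr := mul_le_mul (virial_error_le hC ht) hb₁
      (integral_nonneg fun x => sq_nonneg _) (by
        have : 0 < t := by linarith
        positivity)
    rw [← hA₁] at herr
    have hsech : ∀ x, sech (x / lam C t) = sech (1 / lam C t * x) := fun x => by
      rw [one_div_mul_eq_div]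
    simp only [hsech]
    have hring : 4 * A₁ * ε ^ 2 * (-t⁻¹ / Real.log t ^ 2)
        = -4 * (A₁ * (t⁻¹ / Real.log t ^ 2) * ε ^ 2) := by ring
    rw [hring]
    linarith
  · obtain ⟨ha₁, hb₁, -⟩ := hbounds t ht
    obtain ⟨ha₂, hb₂, -⟩ := hbounds 2 le_rfl
    have h₁ := abs_le.1 (abs_integral_tanh_mul_le (m := 1 / lam C t) (hqu t) (hqv t) ha₁ hb₁)
    have h₂ := abs_le.1 (abs_integral_tanh_mul_le (m := 1 / lam C 2) (hqu 2) (hqv 2) ha₂ hb₂)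
    have hlt : 0 ≤ (Real.log t)⁻¹ := inv_nonneg.2 (Real.log_nonneg (by linarith))
    have hl2 : (Real.log 2)⁻¹ ≤ 2 := inv_le_of_inv_le₀ two_pos (by linarith [Real.log_two_gt_d9])
    have h₃ : A₁ * ε ^ 2 * ((Real.log 2)⁻¹ - (Real.log t)⁻¹) ≤ A₁ * ε ^ 2 * 2 := by
      gcongr
      linarith
    linarith
end

section
/- There exist ε₀ > 0, λ* ≥ 1 and A > 0, depending only on p, K, such that: if the smallness condition holds with some ε ≤ ε₀, then for every fixed λ₀ ≥ λ*, ∫₂^∞ ∫_ℝ sech²(x/λ₀) ((∂ₓu₁)² + u₁² + u₂²)(t,x) dx dt ≤ A·λ₀·ε². -/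
open MeasureTheory Filter

/-- Continuous and bounded. -/
def ContBdd (g : ℝ → ℝ) : Prop := Continuous g ∧ ∃ M, ∀ x, |g x| ≤ M

/-- Continuous and `O((1 + x²)⁻¹)`. -/
def Decays (g : ℝ → ℝ) : Prop := Continuous g ∧ ∃ M, ∀ x, |g x| ≤ M * (1 + x ^ 2)⁻¹

lemma ContBdd.mul {g h : ℝ → ℝ} (hg : ContBdd g) (hh : ContBdd h) :
    ContBdd (fun x => g x * h x) := by
  obtain ⟨cg, M, hM⟩ := hg
  obtain ⟨ch, N, hN⟩ := hh
  refine ⟨cg.mul ch, M * N, fun x => ?_⟩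
  rw [abs_mul]
  exact mul_le_mul (hM x) (hN x) (abs_nonneg _) ((abs_nonneg _).trans (hM x))

lemma ContBdd.add {g h : ℝ → ℝ} (hg : ContBdd g) (hh : ContBdd h) :
    ContBdd (fun x => g x + h x) := by
  obtain ⟨cg, M, hM⟩ := hg
  obtain ⟨ch, N, hN⟩ := hh
  exact ⟨cg.add ch, M + N, fun x => (abs_add_le _ _).trans (add_le_add (hM x) (hN x))⟩

lemma ContBdd.const (c : ℝ) : ContBdd (fun _ => c) := ⟨continuous_const, |c|, fun _ => le_rfl⟩

lemma ContBdd.sub {g h : ℝ → ℝ} (hg : ContBdd g) (hh : ContBdd h) :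
    ContBdd (fun x => g x - h x) := by
  simpa [sub_eq_add_neg] using hg.add ((ContBdd.const (-1)).mul hh)

lemma Decays.contBdd {g : ℝ → ℝ} (hg : Decays g) : ContBdd g := by
  obtain ⟨cg, M, hM⟩ := hg
  have hM0 : 0 ≤ M := by simpa using (abs_nonneg _).trans (hM 0)
  refine ⟨cg, M, fun x => (hM x).trans (mul_le_of_le_one_right hM0 (inv_le_one_of_one_le₀ ?_))⟩
  nlinarith [sq_nonneg x]

lemma ContBdd.mul_decays {g h : ℝ → ℝ} (hg : ContBdd g) (hh : Decays h) :
    Decays (fun x => g x * h x) := by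
  obtain ⟨cg, M, hM⟩ := hg
  obtain ⟨ch, N, hN⟩ := hh
  refine ⟨cg.mul ch, M * N, fun x => ?_⟩
  rw [abs_mul, mul_assoc]
  exact mul_le_mul (hM x) (hN x) (abs_nonneg _) ((abs_nonneg _).trans (hM x))

lemma Decays.add {g h : ℝ → ℝ} (hg : Decays g) (hh : Decays h) :
    Decays (fun x => g x + h x) := by
  obtain ⟨cg, M, hM⟩ := hg
  obtain ⟨ch, N, hN⟩ := hh
  refine ⟨cg.add ch, M + N, fun x => (abs_add_le _ _).trans ?_⟩
  rw [add_mul]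
  exact add_le_add (hM x) (hN x)

lemma Decays.sub {g h : ℝ → ℝ} (hg : Decays g) (hh : Decays h) :
    Decays (fun x => g x - h x) := by
  simpa [sub_eq_add_neg] using hg.add ((ContBdd.const (-1)).mul_decays hh)

lemma Decays.mul {g h : ℝ → ℝ} (hg : Decays g) (hh : Decays h) :
    Decays (fun x => g x * h x) := hg.contBdd.mul_decays hh

lemma Decays.sq {g : ℝ → ℝ} (hg : Decays g) : Decays (fun x => g x ^ 2) := by
  simpa only [_root_.sq] using hg.mul hg

lemma Decays.integrable {g : ℝ → ℝ} (hg : Decays g) : Integrable g := by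
  obtain ⟨cg, M, hM⟩ := hg
  exact (integrable_inv_one_add_sq.const_mul M).mono' cg.aestronglyMeasurable
    (Eventually.of_forall hM)

lemma le_mul_inv_of_weighted_le {M x y : ℝ} (h : (1 + |x|) ^ 2 * |y| ≤ M) :
    |y| ≤ M * (1 + x ^ 2)⁻¹ := by
  rw [← div_eq_mul_inv, le_div_iff₀ (by positivity)]
  nlinarith [abs_nonneg x, abs_nonneg y, sq_abs x, mul_nonneg (abs_nonneg x) (abs_nonneg y)]

lemma hasDerivAt_tanh_div (lam x : ℝ) :
    HasDerivAt (fun y => Real.tanh (y / lam)) ((1 - Real.tanh (x / lam) ^ 2) / lam) x := by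
  have hc : Real.cosh (x / lam) ≠ 0 := (Real.cosh_pos _).ne'
  have h := ((Real.hasDerivAt_sinh (x / lam)).div (Real.hasDerivAt_cosh (x / lam)) hc).comp x
    ((hasDerivAt_id x).div_const lam)
  have he : (fun y => Real.tanh (y / lam))
      = (Real.sinh / Real.cosh) ∘ (fun y => id y / lam) := by
    funext y
    simp [Real.tanh_eq_sinh_div_cosh]
  rw [he]
  refine h.congr_deriv ?_
  rw [Real.tanh_eq_sinh_div_cosh]
  field_simp

lemma sech_sq_eq (x : ℝ) : sech x ^ 2 = 1 - Real.tanh x ^ 2 := by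
  have hc : Real.cosh x ≠ 0 := (Real.cosh_pos _).ne'
  have := Real.cosh_sq x
  rw [sech, Real.tanh_eq_sinh_div_cosh]
  field_simp
  linarith

lemma contBdd_tanh_div (lam : ℝ) : ContBdd (fun x => Real.tanh (x / lam)) :=
  ⟨continuous_iff_continuousAt.2 fun x => (hasDerivAt_tanh_div lam x).continuousAt, 1,
    fun _ => (Real.abs_tanh_lt_one _).le⟩

lemma contBdd_one_sub_tanh_sq (lam : ℝ) : ContBdd (fun x => 1 - Real.tanh (x / lam) ^ 2) := by
  simpa only [sq] using
    (ContBdd.const 1).sub ((contBdd_tanh_div lam).mul (contBdd_tanh_div lam))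

/-- The virial estimate at a fixed time. -/
lemma virial_le {a a1 a2 a3 b b1 f1 G : ℝ → ℝ} {lam : ℝ} (hlam : 4 ≤ lam)
    (ha : Decays a) (ha1 : Decays a1) (ha2 : Decays a2) (ha3 : Decays a3)
    (hb : Decays b) (hb1 : Decays b1)
    (da : ∀ x, HasDerivAt a (a1 x) x) (da1 : ∀ x, HasDerivAt a1 (a2 x) x)
    (da2 : ∀ x, HasDerivAt a2 (a3 x) x) (db : ∀ x, HasDerivAt b (b1 x) x)
    (hf1 : ContBdd (fun x => f1 (a x))) (dG : ∀ s, HasDerivAt G (s * f1 s) s)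
    (hG : ∀ x, |G (a x)| ≤ a x ^ 2 / 8) :
    ∫ x, lam * Real.tanh (x / lam) * (b1 x * b x + a x * (a1 x - a3 x - f1 (a x) * a1 x))
      ≤ -(1 / 4) * ∫ x, sech (x / lam) ^ 2 * (a1 x ^ 2 + a x ^ 2 + b x ^ 2) := by
  have hlam0 : lam ≠ 0 := by linarith
  set τ : ℝ → ℝ := fun x => Real.tanh (x / lam) with hτ
  have dτ : ∀ x, HasDerivAt τ ((1 - τ x ^ 2) / lam) x := hasDerivAt_tanh_div lam
  have bτ : ContBdd τ := contBdd_tanh_div lam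
  have bw : ContBdd (fun x => 1 - τ x ^ 2) := contBdd_one_sub_tanh_sq lam
  have dGa : Decays (fun x => G (a x)) := by
    obtain ⟨_, M, hM⟩ := ha.sq
    refine ⟨continuous_iff_continuousAt.2 fun x =>
      ((dG (a x)).comp x (da x)).continuousAt, M, fun x => ?_⟩
    have h1 := hG x
    have h2 := hM x
    have h3 := le_abs_self (a x ^ 2)
    have h4 := sq_nonneg (a x)
    linarith
  let H : ℝ → ℝ := fun x => lam * τ x * (1 / 2 * b x ^ 2 + 1 / 2 * a x ^ 2 - a x * a2 x
    + 1 / 2 * a1 x ^ 2 - G (a x)) + (1 - τ x ^ 2) * (a x * a1 x)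
    + 1 / lam * (τ x * ((1 - τ x ^ 2) * a x ^ 2))
  let R : ℝ → ℝ := fun x => (1 - τ x ^ 2) * (1 / 2 * b x ^ 2 + 1 / 2 * a x ^ 2
    + 3 / 2 * a1 x ^ 2 - (3 * τ x ^ 2 - 1) / lam ^ 2 * a x ^ 2 - G (a x))
  let J : ℝ → ℝ := fun x => lam * τ x
    * (b1 x * b x + a x * (a1 x - a3 x - f1 (a x) * a1 x))
  let Q : ℝ → ℝ := fun x => (1 - τ x ^ 2) * (a1 x ^ 2 + a x ^ 2 + b x ^ 2)
  have blτ : ContBdd (fun x => lam * τ x) := (ContBdd.const lam).mul bτ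
  have half : ∀ {g : ℝ → ℝ}, Decays g → ∀ c : ℝ, Decays (fun x => c * g x) :=
    fun hg c => (ContBdd.const c).mul_decays hg
  have dH : Decays H := by
    refine ((blτ.mul_decays (((((half hb.sq _).add (half ha.sq _)).sub (ha.mul ha2)).add
      (half ha1.sq _)).sub dGa)).add (bw.mul_decays (ha.mul ha1))).add ?_
    exact half (bτ.mul_decays (bw.mul_decays ha.sq)) _
  have dR : Decays R := by
    refine bw.mul_decays (((((half hb.sq _).add (half ha.sq _)).add (half ha1.sq _)).sub
      (ContBdd.mul_decays ?_ ha.sq)).sub dGa)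
    have : ContBdd (fun x => (2 - 3 * (1 - τ x ^ 2)) * (1 / lam ^ 2)) :=
      ((ContBdd.const 2).sub ((ContBdd.const 3).mul bw)).mul (ContBdd.const _)
    convert this using 2
    ring
  have dJ : Decays J := blτ.mul_decays ((hb1.mul hb).add
    (ha.mul ((ha1.sub ha3).sub (hf1.mul_decays ha1))))
  have dQ : Decays Q := bw.mul_decays ((ha1.sq.add ha.sq).add hb.sq)
  have hH : ∀ x, HasDerivAt H (J x + R x) x := by
    intro x
    have hw : HasDerivAt (fun y => 1 - τ y ^ 2) _ x := ((dτ x).pow 2).const_sub 1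
    have hGa : HasDerivAt (fun y => G (a y)) _ x := (dG (a x)).comp x (da x)
    have hb2 := ((db x).pow 2).const_mul (1 / 2)
    have hsq := (da x).pow 2
    have h1 := ((dτ x).const_mul lam).mul ((((hb2.add (hsq.const_mul (1 / 2))).sub
      ((da x).mul (da2 x))).add (((da1 x).pow 2).const_mul (1 / 2))).sub hGa)
    have h2 := (h1.add (hw.mul ((da x).mul (da1 x)))).add
      (((dτ x).mul (hw.mul hsq)).const_mul (1 / lam))
    refine h2.congr_deriv ?_
    simp only [J, R, Pi.add_apply, Pi.sub_apply, Pi.mul_apply, Pi.pow_apply]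
    field_simp
    ring
  have h0 : ∫ x, (J x + R x) = 0 :=
    integral_eq_zero_of_hasDerivAt_of_integrable hH (dJ.add dR).integrable dH.integrable
  rw [integral_add dJ.integrable dR.integrable] at h0
  have hQR : (1 / 4) * ∫ x, Q x ≤ ∫ x, R x := by
    rw [← integral_const_mul]
    refine integral_mono (dQ.integrable.const_mul _) dR.integrable fun x => ?_
    have hw : 0 ≤ 1 - τ x ^ 2 := by
      have := Real.tanh_sq_lt_one (x / lam)
      simp only [hτ]
      linarith
    have hc : (3 * τ x ^ 2 - 1) / lam ^ 2 ≤ 1 / 8 := by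
      rw [div_le_iff₀ (by positivity)]
      nlinarith
    have hg := (abs_le.1 (hG x)).2
    have hca := mul_le_mul_of_nonneg_right hc (sq_nonneg (a x))
    have : 1 / 4 * (a1 x ^ 2 + a x ^ 2 + b x ^ 2) ≤ 1 / 2 * b x ^ 2 + 1 / 2 * a x ^ 2
        + 3 / 2 * a1 x ^ 2 - (3 * τ x ^ 2 - 1) / lam ^ 2 * a x ^ 2 - G (a x) := by
      linarith [sq_nonneg (a1 x), sq_nonneg (b x)]
    have := mul_le_mul_of_nonneg_left this hw
    simp only [Q, R]
    linarith
  have hQ : ∫ x, sech (x / lam) ^ 2 * (a1 x ^ 2 + a x ^ 2 + b x ^ 2) = ∫ x, Q x := by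
    simp only [sech_sq_eq, Q, hτ]
  rw [hQ]
  change ∫ x, J x ≤ _
  linarith

/-- The primitive `s ↦ ∫₀ˢ r f'(r) dr` is quadratically small near the origin. -/
lemma exists_primitive_small {p K ε₀ : ℝ} (hp : 1 < p) (hK : 0 < K) (h1 : ε₀ ≤ 1)
    (h2 : K * ε₀ ^ (p - 1) ≤ 1 / 8) {f1 : ℝ → ℝ} (hc : Continuous f1)
    (hf : ∀ s : ℝ, |s| ≤ 1 → |f1 s| ≤ K * |s| ^ (p - 1)) :
    ∃ G : ℝ → ℝ, (∀ s, HasDerivAt G (s * f1 s) s) ∧ ∀ s, |s| ≤ ε₀ → |G s| ≤ s ^ 2 / 8 := by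
  have hcont : Continuous (fun r => r * f1 r) := continuous_id.mul hc
  refine ⟨fun s => ∫ r in (0:ℝ)..s, r * f1 r,
    fun s => hcont.integral_hasStrictDerivAt 0 s |>.hasDerivAt, fun s hs => ?_⟩
  have hb : ∀ r ∈ Set.uIoc 0 s, ‖r * f1 r‖ ≤ |s| * (1 / 8) := by
    intro r hr
    have hrs : |r| ≤ |s| := by
      simpa using Set.abs_sub_left_of_mem_uIcc (Set.uIoc_subset_uIcc hr)
    rw [Real.norm_eq_abs, abs_mul]
    refine mul_le_mul hrs ((hf r (by linarith)).trans (le_trans ?_ h2)) (abs_nonneg _)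
      (abs_nonneg _)
    gcongr
    linarith
  have h := intervalIntegral.norm_integral_le_of_norm_le_const hb
  rw [Real.norm_eq_abs, sub_zero] at h
  refine h.trans (le_of_eq ?_)
  rw [← sq_abs s]
  ring

/-- Differentiation under the integral sign of a weighted product of two decaying functions. -/
lemma hasDerivAt_integral_mul_mul {φ : ℝ → ℝ} {u v : ℝ → ℝ → ℝ} (hφ : ContBdd φ)
    (hu : ContDiff ℝ (⊤ : ℕ∞) (fun q : ℝ × ℝ => u q.1 q.2))
    (hv : ContDiff ℝ (⊤ : ℕ∞) (fun q : ℝ × ℝ => v q.1 q.2))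
    (hu' : ∀ T : ℝ, ∀ m k n : ℕ, ∃ M : ℝ, ∀ t ∈ Set.Icc (-T) T, ∀ x : ℝ,
      (1 + |x|) ^ n * |iteratedDeriv k (fun y => iteratedDeriv m (fun s => u s y) t) x| ≤ M)
    (hv' : ∀ T : ℝ, ∀ m k n : ℕ, ∃ M : ℝ, ∀ t ∈ Set.Icc (-T) T, ∀ x : ℝ,
      (1 + |x|) ^ n * |iteratedDeriv k (fun y => iteratedDeriv m (fun s => v s y) t) x| ≤ M)
    (t : ℝ) (hut : Continuous (fun x => deriv (fun s => u s x) t))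
    (hvt : Continuous (fun x => deriv (fun s => v s x) t)) :
    HasDerivAt (fun s => ∫ x, φ x * (u s x * v s x))
      (∫ x, φ x * (deriv (fun s => u s x) t * v t x + u t x * deriv (fun s => v s x) t)) t := by
  obtain ⟨cφ, C, hC⟩ := hφ
  have bound : ∀ w : ℝ → ℝ → ℝ, (∀ T : ℝ, ∀ m k n : ℕ, ∃ M : ℝ, ∀ t ∈ Set.Icc (-T) T, ∀ x : ℝ,
      (1 + |x|) ^ n * |iteratedDeriv k (fun y => iteratedDeriv m (fun s => w s y) t) x| ≤ M) →
      (∃ M, ∀ s ∈ Set.Ioo (t - 1) (t + 1), ∀ x, |w s x| ≤ M * (1 + x ^ 2)⁻¹)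
      ∧ ∃ M, ∀ s ∈ Set.Ioo (t - 1) (t + 1), ∀ x, |deriv (fun s => w s x) s| ≤ M := by
    intro w hw
    have hsub : ∀ s ∈ Set.Ioo (t - 1) (t + 1), s ∈ Set.Icc (-(|t| + 1)) (|t| + 1) := by
      intro s hs
      have h1 := le_abs_self t
      have h2 := neg_abs_le t
      exact ⟨by linarith [hs.1], by linarith [hs.2]⟩
    obtain ⟨M, hM⟩ := hw (|t| + 1) 0 0 2
    obtain ⟨N, hN⟩ := hw (|t| + 1) 1 0 0
    refine ⟨⟨M, fun s hs x => le_mul_inv_of_weighted_le ?_⟩, N, fun s hs x => ?_⟩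
    · simpa using hM s (hsub s hs) x
    · simpa using hN s (hsub s hs) x
  obtain ⟨⟨M, hM⟩, M', hM'⟩ := bound u hu'
  obtain ⟨⟨N, hN⟩, N', hN'⟩ := bound v hv'
  have cu : ∀ s, Continuous (u s) := fun s =>
    hu.continuous.comp (continuous_const.prodMk continuous_id)
  have cv : ∀ s, Continuous (v s) := fun s =>
    hv.continuous.comp (continuous_const.prodMk continuous_id)
  have du : ∀ s x, HasDerivAt (fun r => u r x) (deriv (fun r => u r x) s) s := fun s x =>
    ((hu.comp (contDiff_id.prodMk contDiff_const)).differentiable (by simp) s).hasDerivAt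
  have dv : ∀ s x, HasDerivAt (fun r => v r x) (deriv (fun r => v r x) s) s := fun s x =>
    ((hv.comp (contDiff_id.prodMk contDiff_const)).differentiable (by simp) s).hasDerivAt
  have ht : t ∈ Set.Ioo (t - 1) (t + 1) := ⟨by linarith, by linarith⟩
  have hφd : ContBdd φ := ⟨cφ, C, hC⟩
  refine (hasDerivAt_integral_of_dominated_loc_of_deriv_le
    (s := Set.Ioo (t - 1) (t + 1)) (bound := fun x => C * (M' * N + M * N') * (1 + x ^ 2)⁻¹)
    (F := fun s x => φ x * (u s x * v s x))
    (F' := fun s x => φ x * (deriv (fun r => u r x) s * v s x + u s x * deriv (fun r => v r x) s))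
    (Ioo_mem_nhds ht.1 ht.2) ?_ ?_ ?_ ?_ (integrable_inv_one_add_sq.const_mul _) ?_).2
  · exact Eventually.of_forall fun s => (cφ.mul ((cu s).mul (cv s))).aestronglyMeasurable
  · exact (hφd.mul_decays (Decays.mul ⟨cu t, M, hM t ht⟩ ⟨cv t, N, hN t ht⟩)).integrable
  · exact (cφ.mul ((hut.mul (cv t)).add ((cu t).mul hvt))).aestronglyMeasurable
  · refine Eventually.of_forall fun x s hs => ?_
    have hk : 0 ≤ M * (1 + x ^ 2)⁻¹ := (abs_nonneg _).trans (hM s hs x)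
    have hM'0 : 0 ≤ M' := (abs_nonneg _).trans (hM' s hs x)
    rw [Real.norm_eq_abs, abs_mul, mul_assoc]
    refine mul_le_mul (hC x) ?_ (abs_nonneg _) ((abs_nonneg _).trans (hC x))
    refine (abs_add_le _ _).trans ?_
    rw [abs_mul, abs_mul]
    have e1 := mul_le_mul (hM' s hs x) (hN s hs x) (abs_nonneg _) hM'0
    have e2 := mul_le_mul (hM s hs x) (hN' s hs x) (abs_nonneg _) hk
    linarith
  · exact Eventually.of_forall fun x s _ => ((du s x).mul (dv s x)).const_mul _

lemma decays_iteratedDeriv_slice {u : ℝ → ℝ → ℝ} (hu : ContDiff ℝ (⊤ : ℕ∞) (fun q : ℝ × ℝ => u q.1 q.2))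
    (hu' : ∀ T : ℝ, ∀ m k n : ℕ, ∃ M : ℝ, ∀ t ∈ Set.Icc (-T) T, ∀ x : ℝ,
      (1 + |x|) ^ n * |iteratedDeriv k (fun y => iteratedDeriv m (fun s => u s y) t) x| ≤ M)
    (t : ℝ) (k : ℕ) :
    Decays (iteratedDeriv k (u t))
      ∧ ∀ x, HasDerivAt (iteratedDeriv k (u t)) (iteratedDeriv (k + 1) (u t) x) x := by
  have cu : ContDiff ℝ (⊤ : ℕ∞) (u t) := hu.comp (contDiff_const.prodMk contDiff_id)
  have hd : Differentiable ℝ (iteratedDeriv k (u t)) :=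
    cu.differentiable_iteratedDeriv k (by exact_mod_cast WithTop.coe_lt_top _)
  refine ⟨⟨hd.continuous, ?_⟩, fun x => ?_⟩
  · obtain ⟨M, hM⟩ := hu' |t| 0 k 2
    refine ⟨M, fun x => le_mul_inv_of_weighted_le ?_⟩
    simpa using hM t ⟨neg_abs_le t, le_abs_self t⟩ x
  · rw [iteratedDeriv_succ]
    exact (hd x).hasDerivAt

/-- Integrated local energy estimate with a fixed weight \eqref{Integration_2}. -/
theorem stmt_8 (p K : ℝ) (hp : 1 < p) (hK : 0 < K) :
    ∃ ε₀ > (0:ℝ), ∃ lamstar ≥ (1:ℝ), ∃ A > (0:ℝ),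
    ∀ (f : ℝ → ℝ) (u₁ u₂ : ℝ → ℝ → ℝ),
      ContDiff ℝ (⊤ : ℕ∞) f → f 0 = 0 →
      (∀ s : ℝ, |s| ≤ 1 → |deriv f s| ≤ K * |s| ^ (p - 1)) →
      ContDiff ℝ (⊤ : ℕ∞) (fun q : ℝ × ℝ => u₁ q.1 q.2) →
      ContDiff ℝ (⊤ : ℕ∞) (fun q : ℝ × ℝ => u₂ q.1 q.2) →
      (∀ t x : ℝ, deriv (fun s => u₁ s x) t = deriv (u₂ t) x) →
      (∀ t x : ℝ, deriv (fun s => u₂ s x) t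
        = deriv (fun y => u₁ t y - deriv (deriv (u₁ t)) y - f (u₁ t y)) x) →
      (∀ T : ℝ, ∀ m k n : ℕ, ∃ M : ℝ, ∀ t ∈ Set.Icc (-T) T, ∀ x : ℝ,
        (1 + |x|) ^ n * |iteratedDeriv k (fun y => iteratedDeriv m (fun s => u₁ s y) t) x| ≤ M) →
      (∀ T : ℝ, ∀ m k n : ℕ, ∃ M : ℝ, ∀ t ∈ Set.Icc (-T) T, ∀ x : ℝ,
        (1 + |x|) ^ n * |iteratedDeriv k (fun y => iteratedDeriv m (fun s => u₂ s y) t) x| ≤ M) →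
      ∀ ε : ℝ, 0 < ε → ε ≤ ε₀ →
      (∀ t : ℝ, 2 ≤ t →
        Real.sqrt (∫ x : ℝ, ((u₁ t x) ^ 2 + (deriv (u₁ t) x) ^ 2))
          + Real.sqrt (∫ x : ℝ, (u₂ t x) ^ 2) + (⨆ x : ℝ, |u₁ t x|) ≤ ε) →
      ∀ lam₀ : ℝ, lamstar ≤ lam₀ →
      (∫ t in Set.Ioi (2:ℝ),
          ∫ x : ℝ, sech (x / lam₀) ^ 2 *
            ((deriv (u₁ t) x) ^ 2 + (u₁ t x) ^ 2 + (u₂ t x) ^ 2))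
        ≤ A * lam₀ * ε ^ 2 := by
  obtain ⟨ε₀, hε₀, hε₁, hKε⟩ : ∃ ε₀ > (0:ℝ), ε₀ ≤ 1 ∧ K * ε₀ ^ (p - 1) ≤ 1 / 8 := by
    have hp1 : 0 < p - 1 := by linarith
    refine ⟨min 1 ((1 / (8 * K)) ^ (1 / (p - 1))), by positivity, min_le_left _ _, ?_⟩
    calc K * (min 1 ((1 / (8 * K)) ^ (1 / (p - 1)))) ^ (p - 1)
        ≤ K * ((1 / (8 * K)) ^ (1 / (p - 1))) ^ (p - 1) := by
          gcongr
          exact min_le_right _ _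
      _ = 1 / 8 := by
          rw [← Real.rpow_mul (by positivity), one_div_mul_cancel hp1.ne', Real.rpow_one]
          field_simp
  refine ⟨ε₀, hε₀, 4, by norm_num, 8, by norm_num, ?_⟩
  intro f u v hf _ hf1 hu hv eq1 eq2 hu' hv' ε hε hεε hsmall lam hlam
  have hlam0 : 0 < lam := by linarith
  obtain ⟨G, dG, hG⟩ := exists_primitive_small hp hK hε₁ hKε
    (hf.continuous_deriv (by simp)) hf1
  have df : ∀ s, HasDerivAt f (deriv f s) s := fun s =>
    (hf.differentiable (by simp) s).hasDerivAt
  have su := decays_iteratedDeriv_slice hu hu'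
  have sv := decays_iteratedDeriv_slice hv hv'
  have Du : ∀ t, Decays (u t) := fun t => by simpa using (su t 0).1
  have Du1 : ∀ t, Decays (deriv (u t)) := fun t => by simpa using (su t 1).1
  have Dv : ∀ t, Decays (v t) := fun t => by simpa using (sv t 0).1
  have Dv1 : ∀ t, Decays (deriv (v t)) := fun t => by simpa using (sv t 1).1
  have du : ∀ t x, HasDerivAt (u t) (deriv (u t) x) x := fun t x => by simpa using (su t 0).2 x
  have dv : ∀ t x, HasDerivAt (v t) (deriv (v t) x) x := fun t x => by simpa using (sv t 0).2 x
  have e2 : ∀ t, iteratedDeriv 2 (u t) = deriv (deriv (u t)) := fun t => by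
    rw [iteratedDeriv_succ, iteratedDeriv_one]
  have eq2' : ∀ t x, deriv (fun s => v s x) t
      = deriv (u t) x - iteratedDeriv 3 (u t) x - deriv f (u t x) * deriv (u t) x := by
    intro t x
    rw [eq2, ← e2]
    exact (((du t x).sub ((su t 2).2 x)).sub ((df _).comp x (du t x))).deriv
  let I : ℝ → ℝ := fun t => ∫ x, lam * Real.tanh (x / lam) * (u t x * v t x)
  have bφ : ContBdd (fun x => lam * Real.tanh (x / lam)) :=
    (ContBdd.const lam).mul (contBdd_tanh_div lam)
  have cf1 : ∀ t, Continuous (fun x => deriv f (u t x)) := fun t =>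
    (hf.continuous_deriv (by simp)).comp (Du t).1
  have dI : ∀ t, HasDerivAt I (∫ x, lam * Real.tanh (x / lam) * (deriv (v t) x * v t x
      + u t x * (deriv (u t) x - iteratedDeriv 3 (u t) x - deriv f (u t x) * deriv (u t) x))) t := by
    intro t
    have h := hasDerivAt_integral_mul_mul bφ hu hv hu' hv' t
      (by simpa only [eq1] using (Dv1 t).1)
      (by
        simp only [eq2']
        exact ((Du1 t).1.sub (su t 3).1.1).sub ((cf1 t).mul (Du1 t).1))
    simpa only [eq1, eq2'] using h
  have hsup : ∀ t, 2 ≤ t → ∀ x, |u t x| ≤ ε := by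
    intro t ht x
    obtain ⟨_, M, hM⟩ := (Du t).contBdd
    have h1 : |u t x| ≤ ⨆ x : ℝ, |u t x| :=
      le_ciSup (f := fun x => |u t x|) ⟨M, by rintro _ ⟨y, rfl⟩; exact hM y⟩ x
    have := hsmall t ht
    have h2 := Real.sqrt_nonneg (∫ x : ℝ, ((u t x) ^ 2 + (deriv (u t) x) ^ 2))
    have h3 := Real.sqrt_nonneg (∫ x : ℝ, (v t x) ^ 2)
    linarith
  have hI : ∀ t, 2 ≤ t → |I t| ≤ lam * ε ^ 2 := by
    intro t ht
    have hs := hsmall t ht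
    have h1 := Real.sqrt_nonneg (∫ x : ℝ, ((u t x) ^ 2 + (deriv (u t) x) ^ 2))
    have h2 := Real.sqrt_nonneg (∫ x : ℝ, (v t x) ^ 2)
    have h3 : 0 ≤ ⨆ x : ℝ, |u t x| := Real.iSup_nonneg fun x => abs_nonneg _
    have h4 : ∫ x : ℝ, ((u t x) ^ 2 + (deriv (u t) x) ^ 2) ≤ ε ^ 2 :=
      (Real.sqrt_le_left hε.le).1 (by linarith)
    have h5 : ∫ x : ℝ, (v t x) ^ 2 ≤ ε ^ 2 := (Real.sqrt_le_left hε.le).1 (by linarith)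
    have i1 := ((Du t).sq.add (Du1 t).sq).integrable
    have i2 := (Dv t).sq.integrable
    calc |I t| ≤ ∫ x, lam / 2 * (((u t x) ^ 2 + (deriv (u t) x) ^ 2) + (v t x) ^ 2) := by
          rw [← Real.norm_eq_abs]
          refine norm_integral_le_of_norm_le ((i1.add i2).const_mul _)
            (Eventually.of_forall fun x => ?_)
          rw [Real.norm_eq_abs, abs_mul, abs_mul, abs_mul, abs_of_pos hlam0]
          have hτ := (Real.abs_tanh_lt_one (x / lam)).le
          have hm : |Real.tanh (x / lam)| * (|u t x| * |v t x|) ≤ |u t x| * |v t x| :=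
            mul_le_of_le_one_left (by positivity) hτ
          have := sq_nonneg (deriv (u t) x)
          rw [mul_assoc, div_mul_eq_mul_div, mul_div_assoc]
          refine mul_le_mul_of_nonneg_left ?_ hlam0.le
          nlinarith [sq_nonneg (|u t x| - |v t x|), sq_abs (u t x), sq_abs (v t x)]
      _ = lam / 2 * ((∫ x : ℝ, ((u t x) ^ 2 + (deriv (u t) x) ^ 2)) + ∫ x : ℝ, (v t x) ^ 2) := by
          rw [integral_const_mul, integral_add i1 i2]
      _ ≤ lam * ε ^ 2 := by nlinarith
  by_cases hInt : IntegrableOn (fun t => ∫ x : ℝ, sech (x / lam) ^ 2 *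
      ((deriv (u t) x) ^ 2 + (u t x) ^ 2 + (v t x) ^ 2)) (Set.Ioi 2)
  swap
  · rw [integral_undef hInt]
    positivity
  refine le_of_tendsto (intervalIntegral_tendsto_integral_Ioi 2 hInt tendsto_id) ?_
  filter_upwards [eventually_ge_atTop 2] with T hT
  have key := intervalIntegral.integral_le_sub_of_hasDeriv_right_of_le
    (g := fun t => -4 * I t) hT
    (fun t _ => ((dI t).const_mul (-4)).continuousAt.continuousWithinAt)
    (fun t _ => ((dI t).const_mul (-4)).hasDerivWithinAt)
    ((integrableOn_Icc_iff_integrableOn_Ioc).2 (hInt.mono_set Set.Ioc_subset_Ioi_self)) ?_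
  · refine key.trans ?_
    have h1 := abs_le.1 (hI 2 le_rfl)
    have h2 := abs_le.1 (hI T hT)
    linarith
  · intro t ht
    have hu1 : ∀ x, |u t x| ≤ ε₀ := fun x => (hsup t ht.1.le x).trans hεε
    have hb : ContBdd (fun x => deriv f (u t x)) := by
      refine ⟨cf1 t, K, fun x => (hf1 _ ((hu1 x).trans hε₁)).trans ?_⟩
      exact mul_le_of_le_one_right hK.le
        (Real.rpow_le_one (abs_nonneg _) ((hu1 x).trans hε₁) (by linarith))
    have := virial_le hlam (Du t) (Du1 t) (su t 2).1 (su t 3).1 (Dv t) (Dv1 t) (du t)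
      (fun x => by simpa using (su t 1).2 x) (su t 2).2 (dv t) hb dG (fun x => hG _ (hu1 x))
    linarith
end
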